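/- arXiv:1705.08592 — 3 statements merged into one kernel-verified Lean document; each statement's English description precedes it below -/
import Mathlib

section
/- Let G be a hypomatchable graph of order at least three, and let (H₁, …, H_m) be an odd ear decomposition of G satisfying (H1). Let h₀ be an integer with 1 ≤ h₀ ≤ max{ht(H_i) : 1 ≤ i ≤ m}. Then the set {u_i : 2 ≤ i ≤ m, ht(H_i) = h₀} is an independent set of G, where u_i denotes an endvertex of the path Q(i) such that ht(u_i) = ht(H_i). -/
open SimpleGraph

/-- A graph is hypomatchable if deleting any vertex leaves a graph with a perfect matching. -/
def Hypomatchable {V : Type*} (G : SimpleGraph V) : Prop :=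
  ∀ u : V, ∃ M : (G.induce {u}ᶜ).Subgraph, M.IsPerfectMatching

/-- The set `⋃_{1 ≤ j ≤ i-1} V(H_j)` of vertices of the ears preceding the `i`-th ear. -/
def prevVerts {V : Type*} {G : SimpleGraph V} (H : ℕ → G.Subgraph) (i : ℕ) : Set V :=
  {v | ∃ j, 1 ≤ j ∧ j < i ∧ v ∈ (H j).verts}

/-- The vertex set of `Q(i) = H_i - ⋃_{1 ≤ j ≤ i-1} V(H_j)`. -/
def earQVerts {V : Type*} {G : SimpleGraph V} (H : ℕ → G.Subgraph) (i : ℕ) : Set V :=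
  (H i).verts \ prevVerts H i

/-- `x` is an endvertex of the subgraph `K` (a path): a vertex of `K` of degree one. -/
def IsEndvertex {V : Type*} {G : SimpleGraph V} (K : G.Subgraph) (x : V) : Prop :=
  x ∈ K.verts ∧ Nat.card (K.neighborSet x) = 1

/-- `(H 1, …, H m)` is an odd ear decomposition of `G`: a sequence of pairwise edge-disjoint
subgraphs such that (E1) their vertex sets cover `V(G)`; (E2) each `H i` has an odd number of
edges, at least 3; (E3) `H 1` is a cycle; (E4) for `2 ≤ i ≤ m`, either `H i` is a path and a
vertex of `H i` lies in `⋃_{1 ≤ j ≤ i-1} V(H_j)` exactly when it is an endvertex of `H i`, or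
`H i` is a cycle meeting `⋃_{1 ≤ j ≤ i-1} V(H_j)` in exactly one vertex. -/
def IsOddEarDecomp {V : Type*} (G : SimpleGraph V) (m : ℕ) (H : ℕ → G.Subgraph) : Prop :=
  1 ≤ m ∧
  (∀ i j, 1 ≤ i → i ≤ m → 1 ≤ j → j ≤ m → i ≠ j →
    Disjoint (H i).edgeSet (H j).edgeSet) ∧
  (∀ v : V, ∃ i, 1 ≤ i ∧ i ≤ m ∧ v ∈ (H i).verts) ∧
  (∀ i, 1 ≤ i → i ≤ m → Odd (Nat.card (H i).edgeSet) ∧ 3 ≤ Nat.card (H i).edgeSet) ∧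
  (∃ n, Nonempty ((H 1).coe ≃g cycleGraph n)) ∧
  (∀ i, 2 ≤ i → i ≤ m →
    ((∃ n, Nonempty ((H i).coe ≃g pathGraph n)) ∧
      ∀ x ∈ (H i).verts, (x ∈ prevVerts H i ↔ IsEndvertex (H i) x)) ∨
    ((∃ n, Nonempty ((H i).coe ≃g cycleGraph n)) ∧
      Nat.card ((H i).verts ∩ prevVerts H i : Set V) = 1))

/-- The sequence `(|V(H 1)|, …, |V(H m)|)` of orders of the ears. -/
noncomputable def earOrders {V : Type*} {G : SimpleGraph V} (m : ℕ) (H : ℕ → G.Subgraph) : List ℕ :=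
  (List.range m).map (fun i => Nat.card (H (i + 1)).verts)

/-- Condition (H1): `(H 1, …, H m)` is an odd ear decomposition of `G` whose sequence of
orders `(|V(H 1)|, …, |V(H m)|)` is lexicographically as large as possible among all odd ear
decompositions of `G`. -/
def IsMaxOddEarDecomp {V : Type*} (G : SimpleGraph V) (m : ℕ) (H : ℕ → G.Subgraph) : Prop :=
  IsOddEarDecomp G m H ∧
  ∀ (m' : ℕ) (H' : ℕ → G.Subgraph), IsOddEarDecomp G m' H' →
    ¬ List.Lex (· < ·) (earOrders m H) (earOrders m' H')

theorem card_edgeSet_pathGraph (n : ℕ) : Nat.card (pathGraph (n + 1)).edgeSet = n := by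
  have h : (pathGraph (n + 1)).edgeSet =
      Set.range (fun i : Fin n => s(i.castSucc, i.succ)) := by
    ext e
    induction e with | _ u v =>
    simp only [mem_edgeSet, pathGraph_adj, Set.mem_range, Sym2.eq_iff]
    constructor
    · rintro (h | h)
      · exact ⟨⟨u, by omega⟩, Or.inl ⟨by ext; simp, by ext; simp [h]⟩⟩
      · exact ⟨⟨v, by omega⟩, Or.inr ⟨by ext; simp, by ext; simp [h]⟩⟩
    · rintro ⟨i, ⟨rfl, rfl⟩ | ⟨rfl, rfl⟩⟩ <;> simp
  rw [h, Nat.card_coe_set_eq, Set.ncard_eq_toFinset_card', Set.toFinset_range,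
    Finset.card_image_of_injective]
  · simp
  · intro i j hij
    simp only [Sym2.eq_iff, Fin.ext_iff, Fin.val_castSucc, Fin.val_succ] at hij
    ext
    omega

theorem card_edgeSet_cycleGraph (n : ℕ) : Nat.card (cycleGraph (n + 3)).edgeSet = n + 3 := by
  have h := (cycleGraph (n + 3)).sum_degrees_eq_twice_card_edges
  simp only [cycleGraph_degree_three_le, Finset.sum_const, Finset.card_univ, Fintype.card_fin,
    smul_eq_mul] at h
  rw [Nat.card_eq_fintype_card, ← edgeFinset_card]
  omega

theorem card_edgeSet_le_one_of_le_two (n : ℕ) (hn : n ≤ 2) (K : SimpleGraph (Fin n)) :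
    Nat.card K.edgeSet ≤ 1 := by
  classical
  have h := K.card_edgeFinset_le_card_choose_two
  rw [Nat.card_eq_fintype_card, ← edgeFinset_card]
  refine h.trans ?_
  rw [Fintype.card_fin]
  interval_cases n <;> decide

theorem card_edgeSet_of_iso {V W : Type*} {G : SimpleGraph V} {K : G.Subgraph}
    {A : SimpleGraph W} (φ : K.coe ≃g A) : Nat.card K.edgeSet = Nat.card A.edgeSet := by
  rw [← Nat.card_congr φ.mapEdgeSet, ← K.image_coe_edgeSet_coe, Nat.card_coe_set_eq,
    Set.ncard_image_of_injective _ (Sym2.map.injective Subtype.val_injective),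
    Nat.card_coe_set_eq]

theorem card_verts_of_iso {V : Type*} {G : SimpleGraph V} {K : G.Subgraph} {n : ℕ}
    {A : SimpleGraph (Fin n)} (φ : K.coe ≃g A) : Nat.card K.verts = n := by
  rw [Nat.card_congr φ.toEquiv, Nat.card_fin]

theorem isEndvertex_iff {V : Type*} {G : SimpleGraph V} {K : G.Subgraph} {x : V} :
    IsEndvertex K x ↔ x ∈ K.verts ∧ ∃ y, ∀ z, K.Adj x z ↔ z = y := by
  rw [IsEndvertex, Nat.card_coe_set_eq, Set.ncard_eq_one]
  simp [Set.ext_iff]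

theorem isEndvertex_pathGraph_iso {V : Type*} {G : SimpleGraph V} {K : G.Subgraph} {n : ℕ}
    (φ : K.coe ≃g pathGraph (n + 2)) (k : Fin (n + 2)) :
    IsEndvertex K (φ.symm k) ↔ k.val = 0 ∨ k.val = n + 1 := by
  have hadj : ∀ z, K.Adj (φ.symm k) z ↔
      ∃ j : Fin (n + 2), z = φ.symm j ∧ (k.val + 1 = j ∨ j.val + 1 = k) := by
    intro z
    constructor
    · intro h
      refine ⟨φ ⟨z, h.snd_mem⟩, by simp, ?_⟩
      rw [← pathGraph_adj, ← φ.symm.map_adj_iff]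
      simpa using h
    · rintro ⟨j, rfl, h⟩
      rw [← pathGraph_adj, ← φ.symm.map_adj_iff] at h
      exact h
  have hinj : ∀ i j : Fin (n + 2), (φ.symm i : V) = φ.symm j → i.val = j.val := by
    intro i j h
    exact congrArg Fin.val (φ.symm.injective (Subtype.ext h))
  rw [isEndvertex_iff]
  constructor
  · rintro ⟨-, y, hy⟩
    by_contra! hk
    have h1 := (hy _).1 ((hadj _).2 ⟨⟨k + 1, by omega⟩, rfl, Or.inl rfl⟩)
    have h2 := (hy _).1 ((hadj _).2 ⟨⟨k - 1, by omega⟩, rfl, Or.inr (by simp; omega)⟩)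
    have := hinj _ _ (h1.trans h2.symm)
    simp only at this
    omega
  · refine fun hk => ⟨(φ.symm k).2, ?_⟩
    rcases hk with hk | hk
    · refine ⟨φ.symm ⟨1, by omega⟩, fun z => ?_⟩
      rw [hadj]
      constructor
      · rintro ⟨j, rfl, hj⟩
        congr 2
        ext
        simp only
        omega
      · rintro rfl
        exact ⟨_, rfl, Or.inl (by simp [hk])⟩
    · refine ⟨φ.symm ⟨n, by omega⟩, fun z => ?_⟩
      rw [hadj]
      constructor
      · rintro ⟨j, rfl, hj⟩
        congr 2
        ext
        simp only
        omega
      · rintro rfl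
        exact ⟨_, rfl, Or.inr (by simp [hk])⟩

/-- The subgraph `K` is an ear of odd length `N ≥ 3` over the vertex set `S`, traversed by `f`
from one attachment vertex `f 0` to the other attachment vertex `f N`. -/
structure IsEarTraversal {V : Type*} {G : SimpleGraph V} (K : G.Subgraph) (S : Set V)
    (N : ℕ) (f : ℕ → V) : Prop where
  odd : Odd N
  three_le : 3 ≤ N
  zero_mem : f 0 ∈ S
  last_mem : f N ∈ S
  inj : ∀ i j, 0 < i → i < N → 0 < j → j < N → f i = f j → i = j
  adj : ∀ k < N, K.Adj (f k) (f (k + 1))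
  eq_of_adj : ∀ k v, 0 < k → k < N → K.Adj (f k) v → v = f (k - 1) ∨ v = f (k + 1)
  mem_iff : ∀ v, v ∈ K.verts \ S ↔ ∃ k, 0 < k ∧ k < N ∧ v = f k
  card_le : Nat.card K.verts ≤ N + 1

theorem IsEarTraversal.reverse {V : Type*} {G : SimpleGraph V} {K : G.Subgraph} {S : Set V}
    {N : ℕ} {f : ℕ → V} (h : IsEarTraversal K S N f) :
    IsEarTraversal K S N (fun k => f (N - k)) where
  odd := h.odd
  three_le := h.three_le
  zero_mem := h.last_mem
  last_mem := by simpa using h.zero_mem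
  inj i j hi hi' hj hj' hij := by
    have := h.inj (N - i) (N - j) (by omega) (by omega) (by omega) (by omega) hij
    omega
  adj k hk := by
    have := h.adj (N - (k + 1)) (by omega)
    rw [show N - (k + 1) + 1 = N - k by omega] at this
    exact this.symm
  eq_of_adj k v hk hk' hv := by
    have := h.eq_of_adj (N - k) v (by omega) (by omega) hv
    rw [show N - k - 1 = N - (k + 1) by omega, show N - k + 1 = N - (k - 1) by omega] at this
    exact this.symm
  mem_iff v := by
    rw [h.mem_iff]
    constructor
    · rintro ⟨k, h1, h2, rfl⟩
      exact ⟨N - k, by omega, by omega, by rw [Nat.sub_sub_self h2.le]⟩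
    · rintro ⟨k, h1, h2, rfl⟩
      exact ⟨N - k, by omega, by omega, rfl⟩
  card_le := h.card_le

/-- The subgraph `K` is an odd ear over the vertex set `S`. -/
def IsOddEar {V : Type*} {G : SimpleGraph V} (K : G.Subgraph) (S : Set V) : Prop :=
  (Odd (Nat.card K.edgeSet) ∧ 3 ≤ Nat.card K.edgeSet) ∧
  (((∃ n, Nonempty (K.coe ≃g pathGraph n)) ∧
      ∀ x ∈ K.verts, (x ∈ S ↔ IsEndvertex K x)) ∨
    ((∃ n, Nonempty (K.coe ≃g cycleGraph n)) ∧ Nat.card (K.verts ∩ S : Set V) = 1))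

theorem exists_isEarTraversal_of_pathGraph_iso {V : Type*} {G : SimpleGraph V} {K : G.Subgraph}
    {S : Set V} {n : ℕ} (hodd : Odd (Nat.card K.edgeSet)) (hthree : 3 ≤ Nat.card K.edgeSet)
    (φ : K.coe ≃g pathGraph n) (hS : ∀ x ∈ K.verts, (x ∈ S ↔ IsEndvertex K x)) :
    ∃ N f, IsEarTraversal K S N f := by
  have hcard := card_edgeSet_of_iso φ
  obtain hn | ⟨n, rfl⟩ : n ≤ 1 ∨ ∃ k, n = k + 2 := by
    rcases n with _ | _ | n
    · simp
    · simp
    · exact Or.inr ⟨n, rfl⟩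
  · have := card_edgeSet_le_one_of_le_two n (by omega) (pathGraph n)
    omega
  rw [card_edgeSet_pathGraph] at hcard
  rw [hcard] at hodd hthree
  have hmem : ∀ k < n + 2, ((φ.symm (Fin.ofNat (n + 2) k) : V) ∈ S ↔ k = 0 ∨ k = n + 1) := by
    intro k hk
    rw [hS _ (φ.symm _).2, isEndvertex_pathGraph_iso]
    simp [Nat.mod_eq_of_lt hk]
  have hadj : ∀ (k : ℕ) (j : Fin (n + 2)), k < n + 2 →
      (K.Adj (φ.symm (Fin.ofNat (n + 2) k)) (φ.symm j) ↔ k + 1 = j ∨ j.val + 1 = k) := by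
    intro k j hk
    have := φ.symm.map_adj_iff (v := Fin.ofNat (n + 2) k) (w := j)
    rw [pathGraph_adj] at this
    simpa [Nat.mod_eq_of_lt hk] using this
  refine ⟨n + 1, fun k => φ.symm (Fin.ofNat (n + 2) k), hodd, hthree, ?_, ?_, ?_, ?_, ?_, ?_, ?_⟩
  · exact (hmem 0 (by omega)).2 (Or.inl rfl)
  · exact (hmem (n + 1) (by omega)).2 (Or.inr rfl)
  · intro i j _ hi _ hj hij
    have := congrArg Fin.val (φ.symm.injective (Subtype.ext hij))
    simpa [Nat.mod_eq_of_lt (show i < n + 2 by omega),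
      Nat.mod_eq_of_lt (show j < n + 2 by omega)] using this
  · intro k hk
    rw [hadj k _ (by omega)]
    exact Or.inl (by simp [Nat.mod_eq_of_lt (show k + 1 < n + 2 by omega)])
  · intro k v hk hk' hv
    obtain ⟨j, rfl⟩ : ∃ j, v = φ.symm j := ⟨φ ⟨v, hv.snd_mem⟩, by simp⟩
    rw [hadj k _ (by omega)] at hv
    rcases hv with hv | hv
    · right
      congr 2
      ext
      simp [← hv, Nat.mod_eq_of_lt (show k + 1 < n + 2 by omega)]
    · left
      congr 2
      ext
      simp [← hv]
  · intro v
    constructor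
    · rintro ⟨hv, hvS⟩
      obtain ⟨j, rfl⟩ : ∃ j, v = φ.symm j := ⟨φ ⟨v, hv⟩, by simp⟩
      have := hmem j.val j.2
      have hj : Fin.ofNat (n + 2) j.val = j := by ext; simp
      rw [hj] at this
      rw [this] at hvS
      exact ⟨j.val, by omega, by omega, by rw [hj]⟩
    · rintro ⟨k, hk, hk', rfl⟩
      refine ⟨(φ.symm _).2, ?_⟩
      rw [hmem k (by omega)]
      omega
  · rw [card_verts_of_iso φ]

theorem exists_isEarTraversal_of_cycleGraph_iso {V : Type*} {G : SimpleGraph V}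
    {K : G.Subgraph} {S : Set V} {n : ℕ} (hodd : Odd (Nat.card K.edgeSet))
    (hthree : 3 ≤ Nat.card K.edgeSet) (φ : K.coe ≃g cycleGraph n)
    (hS : Nat.card (K.verts ∩ S : Set V) = 1) : ∃ N f, IsEarTraversal K S N f := by
  have hcard := card_edgeSet_of_iso φ
  obtain hn | ⟨n, rfl⟩ : n ≤ 2 ∨ ∃ k, n = k + 3 := by
    by_cases hn : n ≤ 2
    · exact Or.inl hn
    · exact Or.inr ⟨n - 3, by omega⟩
  · have := card_edgeSet_le_one_of_le_two n hn (cycleGraph n)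
    omega
  rw [card_edgeSet_cycleGraph] at hcard
  rw [hcard] at hodd hthree
  rw [Nat.card_coe_set_eq, Set.ncard_eq_one] at hS
  obtain ⟨c, hc⟩ := hS
  have hcm : c ∈ K.verts ∧ c ∈ S := by
    rw [← Set.mem_inter_iff, hc]
    exact Set.mem_singleton c
  obtain ⟨t, ht⟩ : ∃ t, c = φ.symm t := ⟨φ ⟨c, hcm.1⟩, by simp⟩
  have hmemS : ∀ j, (φ.symm j : V) ∈ S ↔ j = t := by
    intro j
    have : (φ.symm j : V) ∈ K.verts ∩ S ↔ (φ.symm j : V) = c := by rw [hc]; rfl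
    rw [Set.mem_inter_iff, and_iff_right (φ.symm j).2, ht] at this
    rw [this]
    exact ⟨fun h => φ.symm.injective (Subtype.ext h), fun h => by rw [h]⟩
  have hsucc : ∀ k, Fin.ofNat (n + 3) (k + 1) = Fin.ofNat (n + 3) k + 1 := by
    intro k
    ext
    simp [Fin.val_add]
  have hzero : ∀ k, 0 < k → k < n + 3 → Fin.ofNat (n + 3) k ≠ 0 := by
    intro k hk hk' h
    have := congrArg Fin.val h
    simp [Nat.mod_eq_of_lt hk'] at this
    omega
  have hlast : Fin.ofNat (n + 3) (n + 3) = 0 := by ext; simp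
  have hadj : ∀ i j, K.Adj (φ.symm i) (φ.symm j) ↔ i - j = 1 ∨ j - i = 1 := by
    intro i j
    rw [← cycleGraph_adj (n := n + 1)]
    exact φ.symm.map_adj_iff
  refine ⟨n + 3, fun k => φ.symm (t + Fin.ofNat (n + 3) k), hodd, hthree,
    ?_, ?_, ?_, ?_, ?_, ?_, ?_⟩
  · rw [hmemS]
    simp [Fin.ofNat]
  · rw [hmemS, hlast, add_zero]
  · intro i j _ hi _ hj hij
    have := add_left_cancel (φ.symm.injective (Subtype.ext hij))
    have := congrArg Fin.val this
    simpa [Nat.mod_eq_of_lt hi, Nat.mod_eq_of_lt hj] using this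
  · intro k hk
    rw [hadj, hsucc]
    right
    abel
  · intro k v hk hk' hv
    obtain ⟨j, rfl⟩ : ∃ j, v = φ.symm j := ⟨φ ⟨v, hv.snd_mem⟩, by simp⟩
    rw [hadj] at hv
    obtain ⟨k, rfl⟩ : ∃ l, k = l + 1 := ⟨k - 1, by omega⟩
    rcases hv with hv | hv
    · left
      congr 2
      rw [hsucc] at hv
      rw [Nat.add_sub_cancel, ← sub_eq_zero, ← neg_sub, neg_eq_zero, ← sub_eq_zero.2 hv]
      abel
    · right
      congr 2
      rw [hsucc (k + 1), ← hv]
      abel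
  · intro v
    constructor
    · rintro ⟨hv, hvS⟩
      obtain ⟨j, rfl⟩ : ∃ j, v = φ.symm j := ⟨φ ⟨v, hv⟩, by simp⟩
      rw [hmemS] at hvS
      have hj : Fin.ofNat (n + 3) (j - t).val = j - t := by
        ext; simp
      refine ⟨(j - t).val, ?_, (j - t).2, ?_⟩
      · rw [Nat.pos_iff_ne_zero]
        intro h
        exact hvS (sub_eq_zero.1 (Fin.ext h))
      · rw [hj, add_sub_cancel]
    · rintro ⟨k, hk, hk', rfl⟩
      refine ⟨(φ.symm _).2, ?_⟩
      rw [hmemS, add_eq_left]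
      exact hzero k hk hk'
  · rw [card_verts_of_iso φ]
    omega

theorem IsOddEar.exists_isEarTraversal {V : Type*} {G : SimpleGraph V} {K : G.Subgraph}
    {S : Set V} (h : IsOddEar K S) : ∃ N f, IsEarTraversal K S N f := by
  obtain ⟨⟨hodd, hthree⟩, ⟨⟨n, ⟨φ⟩⟩, hS⟩ | ⟨⟨n, ⟨φ⟩⟩, hS⟩⟩ := h
  · exact exists_isEarTraversal_of_pathGraph_iso hodd hthree φ hS
  · exact exists_isEarTraversal_of_cycleGraph_iso hodd hthree φ hS

/-- The list `a :: q ++ [b]` runs through an even number of distinct vertices outside `S`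
between two vertices `a` and `b` (possibly equal) of `S`. -/
structure IsEarList {V : Type*} (G : SimpleGraph V) (S : Set V) (a : V) (q : List V) (b : V) :
    Prop where
  left_mem : a ∈ S
  right_mem : b ∈ S
  nodup : q.Nodup
  even : Even q.length
  notMem : ∀ x ∈ q, x ∉ S
  isChain : List.IsChain G.Adj (a :: q ++ [b])

theorem IsEarList.exists_enum {V : Type*} {G : SimpleGraph V} {S : Set V} {a b : V} {q : List V}
    (h : IsEarList G S a q b) :
    ∃ g : ℕ → V, g 0 = a ∧ g (q.length + 1) = b ∧
      (∀ k ≤ q.length, G.Adj (g k) (g (k + 1))) ∧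
      (∀ x, x ∈ q ↔ ∃ k, 0 < k ∧ k ≤ q.length ∧ x = g k) ∧
      (∀ i j, 0 < i → i ≤ q.length → 0 < j → j ≤ q.length → g i = g j → i = j) := by
  have hq : ∀ k (hk : 0 < k) (hk' : k ≤ q.length),
      (a :: q ++ [b]).getD k a = q[k - 1]'(by omega) := by
    intro k hk hk'
    obtain ⟨k, rfl⟩ : ∃ l, k = l + 1 := ⟨k - 1, by omega⟩
    simp [List.getElem?_append_left (show k < q.length by omega),
      List.getElem?_eq_getElem (show k < q.length by omega)]
  refine ⟨fun k => (a :: q ++ [b]).getD k a, by simp, by simp, ?_, ?_, ?_⟩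
  · intro k hk
    have := h.isChain.getElem k (by simp; omega)
    have h1 := List.getD_eq_getElem (a :: q ++ [b]) a (n := k) (by simp; omega)
    have h2 := List.getD_eq_getElem (a :: q ++ [b]) a (n := k + 1) (by simp; omega)
    simp only [h1, h2]
    exact this
  · intro x
    rw [List.mem_iff_getElem]
    constructor
    · rintro ⟨k, hk, rfl⟩
      exact ⟨k + 1, by omega, hk, (hq (k + 1) (by omega) hk).symm⟩
    · rintro ⟨k, hk, hk', rfl⟩
      exact ⟨k - 1, by omega, (hq k hk hk').symm⟩
  · intro i j hi hi' hj hj' hij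
    simp only [hq i hi hi', hq j hj hj'] at hij
    have := h.nodup.getElem_inj_iff.1 hij
    omega

theorem Copy.mem_verts_toSubgraph {V W : Type*} {G : SimpleGraph V} {A : SimpleGraph W}
    (f : Copy A G) (x : V) : x ∈ f.toSubgraph.verts ↔ ∃ i, f i = x := by
  simp [Copy.toSubgraph]

theorem Copy.adj_toSubgraph {V W : Type*} {G : SimpleGraph V} {A : SimpleGraph W}
    (f : Copy A G) (x y : V) :
    f.toSubgraph.Adj x y ↔ ∃ i j, A.Adj i j ∧ f i = x ∧ f j = y := by
  simp [Copy.toSubgraph, Relation.Map]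

/-- Every ear list with nonempty interior is realised by an odd ear. -/
theorem IsEarList.exists_isOddEar {V : Type*} {G : SimpleGraph V} {S : Set V} {a b : V}
    {q : List V} (h : IsEarList G S a q b) (hne : q ≠ []) :
    ∃ K : G.Subgraph, IsOddEar K S ∧ (∀ x, x ∈ K.verts \ S ↔ x ∈ q) ∧
      q.length + 1 ≤ Nat.card K.verts ∧ (∀ x y, K.Adj x y → x ∈ q ∨ y ∈ q) := by
  obtain ⟨g, hg0, hgl, hadj, hmem, hinj⟩ := h.exists_enum
  obtain ⟨l, hl⟩ : ∃ l, q.length = l + 2 := by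
    have h0 := List.length_pos_of_ne_nil hne
    obtain ⟨r, hr⟩ := h.even
    exact ⟨q.length - 2, by omega⟩
  have hodd : Odd (l + 3) := by
    have := h.even
    rw [hl] at this
    exact this.add_one
  rw [hl] at hgl hadj hmem hinj
  have hgS : ∀ k, 0 < k → k ≤ l + 2 → g k ∉ S := fun k hk hk' =>
    h.notMem _ ((hmem _).2 ⟨k, hk, hk', rfl⟩)
  have hg0S : g 0 ∈ S := hg0 ▸ h.left_mem
  have hglS : g (l + 3) ∈ S := hgl ▸ h.right_mem
  by_cases hab : a = b
  · have hginj : ∀ i j, i ≤ l + 2 → j ≤ l + 2 → g i = g j → i = j := by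
      intro i j hi hj hij
      rcases Nat.eq_zero_or_pos i with rfl | hi0 <;> rcases Nat.eq_zero_or_pos j with rfl | hj0
      · rfl
      · exact absurd (hij ▸ hg0S) (hgS j hj0 hj)
      · exact absurd (hij ▸ hg0S) (hgS i hi0 hi)
      · exact hinj i j hi0 hi hj0 hj hij
    have hstep : ∀ i j : Fin (l + 3), j - i = 1 → G.Adj (g i) (g j) := by
      intro i j hij
      have hj : j = i + 1 := by rw [← hij]; abel
      rcases Nat.lt_or_ge (i.val + 1) (l + 3) with hi | hi
      · have : j.val = i.val + 1 := by
          rw [hj, Fin.val_add, Fin.val_one, Nat.mod_eq_of_lt hi]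
        rw [this]
        exact hadj i (by omega)
      · have hi' : i.val = l + 2 := by omega
        have : j.val = 0 := by
          rw [hj, Fin.val_add, Fin.val_one, hi', Nat.mod_self]
        rw [this, hi', hg0, hab, ← hgl]
        exact hadj (l + 2) le_rfl
    let f : Copy (cycleGraph (l + 3)) G :=
      { toHom :=
          { toFun := fun i => g i
            map_rel' := by
              intro i j hij
              rw [cycleGraph_adj (n := l + 1)] at hij
              rcases hij with hij | hij
              · exact (hstep _ _ hij).symm
              · exact hstep _ _ hij }
        injective' := fun i j hij => Fin.ext (hginj _ _ (by omega) (by omega) hij) }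
    have hf : ∀ i : Fin (l + 3), f i = g i := fun _ => rfl
    have hfS : ∀ i : Fin (l + 3), g i ∈ S ↔ i.val = 0 := by
      intro i
      constructor
      · intro hi
        by_contra h0
        exact hgS i (by omega) (by omega) hi
      · intro hi
        rw [hi]
        exact hg0S
    have hfq : ∀ i : Fin (l + 3), i.val ≠ 0 → g i ∈ q := fun i hi =>
      (hmem _).2 ⟨i, by omega, by omega, rfl⟩
    refine ⟨f.toSubgraph, ⟨?_, Or.inr ⟨⟨l + 3, ⟨f.isoToSubgraph.symm⟩⟩, ?_⟩⟩, ?_, ?_, ?_⟩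
    · rw [card_edgeSet_of_iso f.isoToSubgraph.symm, card_edgeSet_cycleGraph]
      exact ⟨hodd, by omega⟩
    · rw [Nat.card_coe_set_eq, Set.ncard_eq_one]
      refine ⟨g 0, Set.ext fun x => ?_⟩
      rw [Set.mem_inter_iff, Copy.mem_verts_toSubgraph, Set.mem_singleton_iff]
      constructor
      · rintro ⟨⟨i, rfl⟩, hi⟩
        rw [hf] at hi ⊢
        rw [(hfS i).1 hi]
      · rintro rfl
        exact ⟨⟨0, rfl⟩, hg0S⟩
    · intro x
      rw [Set.mem_sdiff, Copy.mem_verts_toSubgraph]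
      constructor
      · rintro ⟨⟨i, rfl⟩, hi⟩
        rw [hf] at hi ⊢
        rw [hfS] at hi
        exact hfq i hi
      · intro hx
        refine ⟨?_, h.notMem x hx⟩
        obtain ⟨k, hk, hk', rfl⟩ := (hmem x).1 hx
        exact ⟨⟨k, by omega⟩, rfl⟩
    · rw [card_verts_of_iso f.isoToSubgraph.symm, hl]
    · intro x y hxy
      obtain ⟨i, j, hij, rfl, rfl⟩ := (Copy.adj_toSubgraph f x y).1 hxy
      rw [hf, hf]
      by_cases hi : i.val = 0
      · right
        refine hfq j fun hj => hij.ne (Fin.ext (hi.trans hj.symm))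
      · exact Or.inl (hfq i hi)
  · have hginj : ∀ i j, i ≤ l + 3 → j ≤ l + 3 → g i = g j → i = j := by
      have key : ∀ i j, i < j → j ≤ l + 3 → g i ≠ g j := by
        intro i j hlt hj hij
        rcases Nat.eq_zero_or_pos i with rfl | hi0
        · rcases Nat.lt_or_ge (l + 2) j with hj' | hj'
          · obtain rfl : j = l + 3 := by omega
            exact hab (by rw [← hg0, ← hgl, hij])
          · exact hgS j hlt hj' (hij ▸ hg0S)
        · rcases Nat.lt_or_ge (l + 2) j with hj' | hj'
          · obtain rfl : j = l + 3 := by omega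
            exact hgS i hi0 (by omega) (hij ▸ hglS)
          · exact hlt.ne (hinj i j hi0 (by omega) (by omega) hj' hij)
      intro i j hi hj hij
      rcases lt_trichotomy i j with hlt | heq | hlt
      · exact absurd hij (key i j hlt hj)
      · exact heq
      · exact absurd hij.symm (key j i hlt hi)
    let f : Copy (pathGraph (l + 4)) G :=
      { toHom :=
          { toFun := fun i => g i
            map_rel' := by
              intro i j hij
              rw [pathGraph_adj] at hij
              rcases hij with hij | hij
              · rw [← hij]
                exact hadj i (by omega)
              · rw [← hij]
                exact (hadj j (by omega)).symm }
        injective' := fun i j hij => Fin.ext (hginj _ _ (by omega) (by omega) hij) }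
    have hf : ∀ i : Fin (l + 4), f i = g i := fun _ => rfl
    have hfS : ∀ i : Fin (l + 4), g i ∈ S ↔ i.val = 0 ∨ i.val = l + 3 := by
      intro i
      constructor
      · intro hi
        by_contra! h0
        exact hgS i (by omega) (by omega) hi
      · rintro (hi | hi) <;> rw [hi]
        · exact hg0S
        · exact hglS
    have hfq : ∀ i : Fin (l + 4), i.val ≠ 0 → i.val ≠ l + 3 → g i ∈ q := fun i hi hi' =>
      (hmem _).2 ⟨i, by omega, by omega, rfl⟩
    refine ⟨f.toSubgraph, ⟨?_, Or.inl ⟨⟨l + 4, ⟨f.isoToSubgraph.symm⟩⟩, ?_⟩⟩, ?_, ?_, ?_⟩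
    · rw [card_edgeSet_of_iso f.isoToSubgraph.symm, card_edgeSet_pathGraph]
      exact ⟨hodd, by omega⟩
    · intro x hx
      obtain ⟨i, rfl⟩ := (Copy.mem_verts_toSubgraph f x).1 hx
      exact (hfS i).trans (isEndvertex_pathGraph_iso f.isoToSubgraph.symm i).symm
    · intro x
      rw [Set.mem_sdiff, Copy.mem_verts_toSubgraph]
      constructor
      · rintro ⟨⟨i, rfl⟩, hi⟩
        rw [hf] at hi ⊢
        rw [hfS, not_or] at hi
        exact hfq i hi.1 hi.2
      · intro hx
        refine ⟨?_, h.notMem x hx⟩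
        obtain ⟨k, hk, hk', rfl⟩ := (hmem x).1 hx
        exact ⟨⟨k, by omega⟩, rfl⟩
    · rw [card_verts_of_iso f.isoToSubgraph.symm, hl]
      omega
    · intro x y hxy
      obtain ⟨i, j, hij, rfl, rfl⟩ := (Copy.adj_toSubgraph f x y).1 hxy
      rw [hf, hf]
      rw [pathGraph_adj] at hij
      by_cases hi : i.val = 0 ∨ i.val = l + 3
      · exact Or.inr (hfq j (by omega) (by omega))
      · exact Or.inl (hfq i (by omega) (by omega))

theorem IsEarTraversal.eq_last_of_isPath {V : Type*} {G : SimpleGraph V} {K : G.Subgraph}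
    {S : Set V} {N : ℕ} {f : ℕ → V} (h : IsEarTraversal K S N f) {x y : V} (W : G.Walk x y) :
    ∀ k, x = f k → 0 < k → k < N → W.IsPath → (∀ e ∈ W.edges, e ∈ K.edgeSet) → y ∈ S →
      (∀ z ∈ W.support, z ∈ S → z = y) → W.snd = f (k + 1) →
      y = f N ∧ W.length = N - k ∧ ∀ z, z ∈ W.support ↔ ∃ j, k ≤ j ∧ j ≤ N ∧ z = f j := by
  induction W with
  | nil =>
    intro k hx hk hk' _ _ hy
    have := (h.mem_iff (f k)).2 ⟨k, hk, hk', rfl⟩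
    exact absurd (hx ▸ hy) this.2
  | @cons x v y hxv p ih =>
    intro k hx hk hk' hW he hy hS hv
    subst hx
    rw [Walk.cons_isPath_iff] at hW
    simp only [Walk.edges_cons, List.mem_cons, forall_eq_or_imp, Subgraph.mem_edgeSet] at he
    simp only [Walk.support_cons, List.mem_cons, forall_eq_or_imp] at hS
    simp only [Walk.snd_cons] at hv
    rcases Nat.lt_or_ge (k + 1) N with hN | hN
    · have hsnd : p.snd = f (k + 1 + 1) := by
        cases p with
        | nil => exact absurd (hv ▸ hy) ((h.mem_iff _).2 ⟨k + 1, by omega, hN, rfl⟩).2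
        | @cons _ w _ hvw p =>
          rw [Walk.snd_cons]
          have hvw' : K.Adj v w := by simpa using he.2 s(v, w) (by simp)
          rcases h.eq_of_adj (k + 1) w (by omega) hN (hv ▸ hvw') with hw | hw
          · refine absurd ?_ hW.2
            rw [Nat.add_sub_cancel] at hw
            rw [← hw]
            simp
          · exact hw
      obtain ⟨h1, h2, h3⟩ := ih (k + 1) hv (by omega) hN hW.1 he.2 hy hS.2 hsnd
      refine ⟨h1, by rw [Walk.length_cons, h2]; omega, fun z => ?_⟩
      rw [Walk.support_cons, List.mem_cons, h3]
      constructor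
      · rintro (rfl | ⟨j, hj, hj', rfl⟩)
        · exact ⟨k, le_rfl, hk'.le, rfl⟩
        · exact ⟨j, by omega, hj', rfl⟩
      · rintro ⟨j, hj, hj', rfl⟩
        rcases Nat.eq_or_lt_of_le hj with rfl | hlt
        · exact Or.inl rfl
        · exact Or.inr ⟨j, hlt, hj', rfl⟩
    · obtain rfl : N = k + 1 := by omega
      obtain rfl : v = y := hS.2 v p.start_mem_support (hv ▸ h.last_mem)
      obtain rfl := Walk.eq_nil_iff_nil.2 (Walk.isPath_iff_nil.1 hW.1)
      refine ⟨hv, by simp, fun z => ?_⟩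
      simp only [Walk.support_cons, Walk.support_nil, List.mem_cons, List.not_mem_nil, or_false]
      constructor
      · rintro (rfl | rfl)
        · exact ⟨k, le_rfl, by omega, rfl⟩
        · exact ⟨k + 1, by omega, le_rfl, hv⟩
      · rintro ⟨j, hj, hj', rfl⟩
        rcases Nat.eq_or_lt_of_le hj with rfl | hlt
        · exact Or.inl rfl
        · obtain rfl : j = k + 1 := by omega
          exact Or.inr hv.symm

/-- A path inside an ear from an interior vertex to an attachment vertex is a final segment of
the ear, for a suitable direction of traversal. -/
theorem IsEarTraversal.exists_of_isPath {V : Type*} {G : SimpleGraph V} {K : G.Subgraph}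
    {S : Set V} {N : ℕ} {f : ℕ → V} (h : IsEarTraversal K S N f) {x y : V} (W : G.Walk x y)
    (hx : x ∈ K.verts \ S) (hW : W.IsPath) (he : ∀ e ∈ W.edges, e ∈ K.edgeSet) (hy : y ∈ S)
    (hS : ∀ z ∈ W.support, z ∈ S → z = y) :
    ∃ g k, IsEarTraversal K S N g ∧ 0 < k ∧ k < N ∧ x = g k ∧ W.length = N - k ∧
      ∀ z, z ∈ W.support ↔ ∃ j, k ≤ j ∧ j ≤ N ∧ z = g j := by
  obtain ⟨k, hk, hk', rfl⟩ := (h.mem_iff x).1 hx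
  have hadj : K.Adj (f k) W.snd := by
    cases W with
    | nil => exact absurd hy hx.2
    | cons hxv p => simpa using he s(_, _) (by simp)
  rcases h.eq_of_adj k _ hk hk' hadj with hsnd | hsnd
  · obtain ⟨-, h2, h3⟩ := h.reverse.eq_last_of_isPath W (N - k) (by rw [Nat.sub_sub_self hk'.le])
      (by omega) (by omega) hW he hy hS
      (by rw [hsnd, show N - (N - k + 1) = k - 1 by omega])
    exact ⟨_, N - k, h.reverse, by omega, by omega, by rw [Nat.sub_sub_self hk'.le], h2, h3⟩
  · obtain ⟨-, h2, h3⟩ := h.eq_last_of_isPath W k rfl hk hk' hW he hy hS hsnd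
    exact ⟨f, k, h, hk, hk', rfl, h2, h3⟩

theorem IsEarTraversal.isChain {V : Type*} {G : SimpleGraph V} {K : G.Subgraph} {S : Set V}
    {N : ℕ} {f : ℕ → V} (h : IsEarTraversal K S N f) (l : ℕ) (hl : l < N) :
    List.IsChain G.Adj (f 0 :: (List.range' 1 l).map f ++ [f (l + 1)]) := by
  have : f 0 :: (List.range' 1 l).map f ++ [f (l + 1)] = (List.range' 0 (l + 2)).map f := by
    rw [List.range'_concat, List.map_append, List.range'_succ]
    simp
  rw [this, List.isChain_map]
  refine List.isChain_iff_getElem.2 fun i hi => ?_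
  simp only [List.getElem_range']
  simp only [List.length_range'] at hi
  have := (h.adj i (by omega)).adj_sub
  simpa using this

/-- The vertices of `A` outside `S` can be added to `S` by one (possibly trivial) ear list. -/
def HasEarOver {V : Type*} (G : SimpleGraph V) (S A : Set V) : Prop :=
  ∃ a q b, IsEarList G S a q b ∧ ∀ x, x ∈ q ↔ x ∈ A \ S

theorem HasEarOver.mono {V : Type*} {G : SimpleGraph V} {S T A : Set V} (h : HasEarOver G S A)
    (hST : S ⊆ T) (hA : ∀ x ∈ A, x ∈ T → x ∈ S) : HasEarOver G T A := by
  obtain ⟨a, q, b, hq, hqA⟩ := h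
  have hqA' : ∀ x, x ∈ q ↔ x ∈ A \ T := fun x => (hqA x).trans
    ⟨fun hx => ⟨hx.1, fun hT => hx.2 (hA x hx.1 hT)⟩, fun hx => ⟨hx.1, fun h => hx.2 (hST h)⟩⟩
  exact ⟨a, q, b, ⟨hST hq.left_mem, hST hq.right_mem, hq.nodup, hq.even,
    fun x hx => ((hqA' x).1 hx).2, hq.isChain⟩, hqA'⟩

theorem IsEarTraversal.hasEarOver_of_initial {V : Type*} {G : SimpleGraph V} {K : G.Subgraph}
    {S T : Set V} {N k : ℕ} {f : ℕ → V} (h : IsEarTraversal K S N f) (hk : k < N)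
    (heven : Even k) (hT0 : S ⊆ T) (hTk : f (k + 1) ∈ T)
    (hT : ∀ j, 0 < j → j < N → (f j ∈ T ↔ k < j)) : HasEarOver G T K.verts := by
  refine ⟨f 0, (List.range' 1 k).map f, f (k + 1), ⟨hT0 h.zero_mem, hTk, ?_, ?_, ?_, ?_⟩, ?_⟩
  · refine List.Nodup.map_on ?_ List.nodup_range'
    intro i hi j hj hij
    rw [List.mem_range'_1] at hi hj
    exact h.inj i j (by omega) (by omega) (by omega) (by omega) hij
  · simpa using heven
  · intro x hx
    obtain ⟨j, hj, rfl⟩ := List.mem_map.1 hx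
    rw [List.mem_range'_1] at hj
    rw [hT j (by omega) (by omega)]
    omega
  · exact h.isChain k hk
  · intro x
    rw [List.mem_map]
    constructor
    · rintro ⟨j, hj, rfl⟩
      rw [List.mem_range'_1] at hj
      refine ⟨((h.mem_iff _).2 ⟨j, by omega, by omega, rfl⟩).1, ?_⟩
      rw [hT j (by omega) (by omega)]
      omega
    · rintro ⟨hxK, hxT⟩
      obtain ⟨j, hj, hj', rfl⟩ := (h.mem_iff x).1 ⟨hxK, fun hS => hxT (hT0 hS)⟩
      rw [hT j hj hj'] at hxT
      exact ⟨j, List.mem_range'_1.2 (by omega), rfl⟩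

theorem IsOddEar.hasEarOver {V : Type*} {G : SimpleGraph V} {K : G.Subgraph} {S : Set V}
    (h : IsOddEar K S) : HasEarOver G S K.verts := by
  obtain ⟨N, f, hf⟩ := h.exists_isEarTraversal
  have h3 := hf.three_le
  obtain ⟨r, hr⟩ := hf.odd
  refine hf.hasEarOver_of_initial (k := N - 1) (by omega) ⟨r, by omega⟩ subset_rfl ?_ ?_
  · rw [show N - 1 + 1 = N by omega]
    exact hf.last_mem
  · intro j hj hj'
    exact iff_of_false ((hf.mem_iff (f j)).2 ⟨j, hj, hj', rfl⟩).2 (by omega)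

/-- A path of even length inside an ear, from an interior vertex to an attachment vertex,
leaves over an initial segment of the ear that can be added afterwards. -/
theorem IsOddEar.hasEarOver_union_support {V : Type*} {G : SimpleGraph V} {K : G.Subgraph}
    {S : Set V} (h : IsOddEar K S) {x y : V} (W : G.Walk x y) (hx : x ∈ K.verts \ S)
    (hW : W.IsPath) (he : ∀ e ∈ W.edges, e ∈ K.edgeSet) (hy : y ∈ S)
    (hS : ∀ z ∈ W.support, z ∈ S → z = y) (heven : Even W.length) :
    HasEarOver G (S ∪ {z | z ∈ W.support}) K.verts := by
  obtain ⟨N, f, hf⟩ := h.exists_isEarTraversal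
  obtain ⟨g, k, hg, hk, hk', rfl, hlen, hsupp⟩ := hf.exists_of_isPath W hx hW he hy hS
  obtain ⟨r, hr⟩ := hf.odd
  obtain ⟨s, hs⟩ := heven
  refine hg.hasEarOver_of_initial (k := k - 1) (by omega) ⟨r - s, by omega⟩
    Set.subset_union_left (Or.inr ?_) ?_
  · rw [Nat.sub_add_cancel hk]
    exact W.start_mem_support
  · intro j hj hj'
    have hjS := ((hg.mem_iff (g j)).2 ⟨j, hj, hj', rfl⟩).2
    rw [Set.mem_union, or_iff_right hjS, Set.mem_ofPred_eq, hsupp]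
    constructor
    · rintro ⟨i, hi, hi', hij⟩
      rcases Nat.eq_or_lt_of_le hi' with rfl | hi'
      · exact absurd (hij ▸ hg.last_mem) hjS
      · have := hg.inj j i hj hj' (by omega) hi' hij
        omega
    · intro hkj
      exact ⟨j, by omega, hj'.le, rfl⟩

theorem IsOddEar.mem_verts_of_mem_support {V : Type*} {G : SimpleGraph V} {K : G.Subgraph}
    {S : Set V} (h : IsOddEar K S) {x y : V} (W : G.Walk x y) (hx : x ∈ K.verts \ S)
    (hW : W.IsPath) (he : ∀ e ∈ W.edges, e ∈ K.edgeSet) (hy : y ∈ S)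
    (hS : ∀ z ∈ W.support, z ∈ S → z = y) {z : V} (hz : z ∈ W.support) : z ∈ K.verts := by
  obtain ⟨N, f, hf⟩ := h.exists_isEarTraversal
  obtain ⟨g, k, hg, hk, hk', rfl, hlen, hsupp⟩ := hf.exists_of_isPath W hx hW he hy hS
  obtain ⟨j, hj, hj', rfl⟩ := (hsupp z).1 hz
  rcases Nat.eq_or_lt_of_le hj' with rfl | hlt
  · have := (hg.adj (j - 1) (by omega)).snd_mem
    rwa [Nat.sub_add_cancel (by omega)] at this
  · exact (hg.adj j hlt).fst_mem

/-- From an endvertex of the interior of an ear, the path of even length to an attachment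
vertex runs through the whole interior. -/
theorem IsOddEar.subset_support_of_isEndvertex {V : Type*} {G : SimpleGraph V}
    {K : G.Subgraph} {S : Set V} (h : IsOddEar K S) {x y : V} (W : G.Walk x y)
    (hx : x ∈ K.verts \ S) (hW : W.IsPath) (he : ∀ e ∈ W.edges, e ∈ K.edgeSet) (hy : y ∈ S)
    (hS : ∀ z ∈ W.support, z ∈ S → z = y) (heven : Even W.length)
    (hend : IsEndvertex (K.deleteVerts S) x) :
    (∀ z ∈ K.verts \ S, z ∈ W.support) ∧ Nat.card K.verts ≤ W.length + 2 := by
  obtain ⟨N, f, hf⟩ := h.exists_isEarTraversal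
  obtain ⟨g, k, hg, hk, hk', rfl, hlen, hsupp⟩ := hf.exists_of_isPath W hx hW he hy hS
  obtain ⟨r, hr⟩ := hf.odd
  obtain ⟨s, hs⟩ := heven
  have hQ : ∀ j, 0 < j → j < N → g j ∈ K.verts \ S := fun j hj hj' =>
    (hg.mem_iff _).2 ⟨j, hj, hj', rfl⟩
  obtain rfl : k = 1 := by
    by_contra hne
    obtain ⟨-, w, hw⟩ := isEndvertex_iff.1 hend
    have h1 := hQ (k - 1) (by omega) (by omega)
    have h2 := hQ (k + 1) (by omega) (by omega)
    have e1 : g (k - 1) = w := by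
      have hadj := (hg.adj (k - 1) (by omega)).symm
      rw [Nat.sub_add_cancel hk] at hadj
      exact (hw _).1 (Subgraph.deleteVerts_adj.2 ⟨hx.1, hx.2, h1.1, h1.2, hadj⟩)
    have e2 : g (k + 1) = w :=
      (hw _).1 (Subgraph.deleteVerts_adj.2 ⟨hx.1, hx.2, h2.1, h2.2, hg.adj k hk'⟩)
    have := hg.inj _ _ (by omega) (by omega) (by omega) (by omega) (e1.trans e2.symm)
    omega
  constructor
  · intro z hz
    obtain ⟨j, hj, hj', rfl⟩ := (hg.mem_iff z).1 hz
    exact (hsupp _).2 ⟨j, hj, hj'.le, rfl⟩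
  · have := hg.card_le
    omega

/-- A sequence of `m` ears satisfying all requirements on an odd ear decomposition except that
the ears need not cover all vertices. -/
structure IsPartialOddEarDecomp {V : Type*} (G : SimpleGraph V) (m : ℕ) (H : ℕ → G.Subgraph) :
    Prop where
  one_le : 1 ≤ m
  disjoint : ∀ i j, 1 ≤ i → i ≤ m → 1 ≤ j → j ≤ m → i ≠ j →
    Disjoint (H i).edgeSet (H j).edgeSet
  odd_one : Odd (Nat.card (H 1).edgeSet) ∧ 3 ≤ Nat.card (H 1).edgeSet
  cycle : ∃ n, Nonempty ((H 1).coe ≃g cycleGraph n)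
  isOddEar : ∀ i, 2 ≤ i → i ≤ m → IsOddEar (H i) (prevVerts H i)

theorem IsOddEarDecomp.isPartialOddEarDecomp {V : Type*} {G : SimpleGraph V} {m : ℕ}
    {H : ℕ → G.Subgraph} (h : IsOddEarDecomp G m H) : IsPartialOddEarDecomp G m H := by
  obtain ⟨h1, h2, -, h4, h5, h6⟩ := h
  exact ⟨h1, h2, h4 1 le_rfl h1, h5, fun i hi hi' => ⟨h4 i (by omega) hi', h6 i hi hi'⟩⟩

theorem IsPartialOddEarDecomp.isOddEarDecomp {V : Type*} {G : SimpleGraph V} {m : ℕ}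
    {H : ℕ → G.Subgraph} (h : IsPartialOddEarDecomp G m H)
    (hcover : prevVerts H (m + 1) = Set.univ) : IsOddEarDecomp G m H := by
  refine ⟨h.one_le, h.disjoint, ?_, ?_, h.cycle, fun i hi hi' => (h.isOddEar i hi hi').2⟩
  · intro v
    obtain ⟨i, hi, hi', hv⟩ : v ∈ prevVerts H (m + 1) := hcover ▸ Set.mem_univ v
    exact ⟨i, hi, by omega, hv⟩
  · intro i hi hi'
    rcases Nat.eq_or_lt_of_le hi with rfl | hlt
    · exact h.odd_one
    · exact (h.isOddEar i hlt hi').1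

theorem IsPartialOddEarDecomp.of_le {V : Type*} {G : SimpleGraph V} {m n : ℕ}
    {H : ℕ → G.Subgraph} (h : IsPartialOddEarDecomp G m H) (hn : 1 ≤ n) (hnm : n ≤ m) :
    IsPartialOddEarDecomp G n H where
  one_le := hn
  disjoint i j hi hi' hj hj' := h.disjoint i j hi (hi'.trans hnm) hj (hj'.trans hnm)
  odd_one := h.odd_one
  cycle := h.cycle
  isOddEar i hi hi' := h.isOddEar i hi (hi'.trans hnm)

theorem prevVerts_congr {V : Type*} {G : SimpleGraph V} {H H' : ℕ → G.Subgraph} {i : ℕ}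
    (h : ∀ j < i, H' j = H j) : prevVerts H' i = prevVerts H i := by
  ext v
  constructor
  · rintro ⟨j, hj, hj', hv⟩
    exact ⟨j, hj, hj', h j hj' ▸ hv⟩
  · rintro ⟨j, hj, hj', hv⟩
    exact ⟨j, hj, hj', (h j hj').symm ▸ hv⟩

theorem prevVerts_mono {V : Type*} {G : SimpleGraph V} (H : ℕ → G.Subgraph) {i j : ℕ}
    (hij : i ≤ j) : prevVerts H i ⊆ prevVerts H j := by
  rintro v ⟨k, hk, hk', hv⟩
  exact ⟨k, hk, by omega, hv⟩

theorem prevVerts_succ {V : Type*} {G : SimpleGraph V} (H : ℕ → G.Subgraph) {i : ℕ}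
    (hi : 1 ≤ i) : prevVerts H (i + 1) = prevVerts H i ∪ (H i).verts := by
  ext v
  constructor
  · rintro ⟨k, hk, hk', hv⟩
    rcases Nat.eq_or_lt_of_le (Nat.le_of_lt_succ hk') with rfl | hlt
    · exact Or.inr hv
    · exact Or.inl ⟨k, hk, hlt, hv⟩
  · rintro (hv | hv)
    · exact prevVerts_mono H (Nat.le_succ i) hv
    · exact ⟨i, hi, by omega, hv⟩

theorem IsPartialOddEarDecomp.exists_extend {V : Type*} {G : SimpleGraph V} {m : ℕ}
    {H : ℕ → G.Subgraph} (h : IsPartialOddEarDecomp G m H) {a b : V} {q : List V}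
    (hq : IsEarList G (prevVerts H (m + 1)) a q b) (hne : q ≠ []) :
    ∃ H' : ℕ → G.Subgraph, IsPartialOddEarDecomp G (m + 1) H' ∧ (∀ j ≤ m, H' j = H j) ∧
      prevVerts H' (m + 2) = prevVerts H (m + 1) ∪ {x | x ∈ q} ∧
      q.length + 1 ≤ Nat.card (H' (m + 1)).verts := by
  obtain ⟨K, hK, hKq, hcard, hedge⟩ := hq.exists_isOddEar hne
  have hm := h.one_le
  have hold : ∀ j ≤ m, Function.update H (m + 1) K j = H j := fun j hj =>
    Function.update_of_ne (by omega) _ _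
  have hnew : Function.update H (m + 1) K (m + 1) = K := Function.update_self ..
  have hprev : ∀ i ≤ m + 1, prevVerts (Function.update H (m + 1) K) i = prevVerts H i :=
    fun i hi => prevVerts_congr fun j hj => hold j (by omega)
  have hdisj : ∀ i, 1 ≤ i → i ≤ m → Disjoint (H i).edgeSet K.edgeSet := by
    intro i hi hi'
    rw [Set.disjoint_left]
    intro e
    induction e with | _ x y =>
    intro hH hKe
    rw [Subgraph.mem_edgeSet] at hH hKe
    rcases hedge x y hKe with hx | hy
    · exact hq.notMem x hx ⟨i, hi, by omega, hH.fst_mem⟩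
    · exact hq.notMem y hy ⟨i, hi, by omega, hH.snd_mem⟩
  refine ⟨Function.update H (m + 1) K, ⟨by omega, ?_, ?_, ?_, ?_⟩, hold, ?_, ?_⟩
  · intro i j hi hi' hj hj' hij
    rcases Nat.eq_or_lt_of_le hi' with rfl | hi'' <;>
      rcases Nat.eq_or_lt_of_le hj' with rfl | hj''
    · exact absurd rfl hij
    · rw [hnew, hold j (by omega)]
      exact (hdisj j hj (by omega)).symm
    · rw [hnew, hold i (by omega)]
      exact hdisj i hi (by omega)
    · rw [hold i (by omega), hold j (by omega)]
      exact h.disjoint i j hi (by omega) hj (by omega) hij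
  · rw [hold 1 hm]
    exact h.odd_one
  · rw [hold 1 hm]
    exact h.cycle
  · intro i hi hi'
    rw [hprev i hi']
    rcases Nat.eq_or_lt_of_le hi' with rfl | hi''
    · rwa [hnew]
    · rw [hold i (by omega)]
      exact h.isOddEar i hi (by omega)
  · rw [prevVerts_succ _ (by omega), hprev _ le_rfl, hnew]
    ext x
    have := hKq x
    simp only [Set.mem_sdiff] at this
    simp only [Set.mem_union, Set.mem_ofPred_eq, ← this]
    tauto
  · rwa [hnew]

/-- `T` arises from `S` by successively adding ears. -/
inductive EarReachable {V : Type*} (G : SimpleGraph V) (S : Set V) : Set V → Prop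
  | refl : EarReachable G S S
  | step {T : Set V} {a b : V} {q : List V} : EarReachable G S T → IsEarList G T a q b →
      q ≠ [] → EarReachable G S (T ∪ {x | x ∈ q})

theorem EarReachable.union_of_hasEarOver {V : Type*} {G : SimpleGraph V} {S T A : Set V}
    (h : EarReachable G S T) (hA : HasEarOver G T A) : EarReachable G S (T ∪ A) := by
  obtain ⟨a, q, b, hq, hqA⟩ := hA
  have hTA : T ∪ A = T ∪ {x | x ∈ q} := by
    ext x
    simp only [Set.mem_union, Set.mem_ofPred_eq, hqA, Set.mem_sdiff]
    tauto
  rw [hTA]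
  by_cases hne : q = []
  · simpa [hne] using h
  · exact h.step hq hne

theorem EarReachable.exists_extend {V : Type*} {G : SimpleGraph V} {S T : Set V}
    (hST : EarReachable G S T) {m : ℕ} {H : ℕ → G.Subgraph} (h : IsPartialOddEarDecomp G m H)
    (hS : prevVerts H (m + 1) = S) :
    ∃ m' H', m ≤ m' ∧ IsPartialOddEarDecomp G m' H' ∧ (∀ j ≤ m, H' j = H j) ∧
      prevVerts H' (m' + 1) = T := by
  induction hST with
  | refl => exact ⟨m, H, le_rfl, h, fun _ _ => rfl, hS⟩
  | step _ hq hne ih =>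
    obtain ⟨m', H', hm, hH', hold, rfl⟩ := ih
    obtain ⟨H'', hH'', hold', hprev, -⟩ := hH'.exists_extend hq hne
    exact ⟨m' + 1, H'', by omega, hH'',
      fun j hj => (hold' j (hj.trans hm)).trans (hold j hj), hprev⟩

theorem lex_earOrders {V : Type*} {G : SimpleGraph V} {m m' n : ℕ} {H H' : ℕ → G.Subgraph}
    (hn : n < m) (hn' : n < m') (heq : ∀ j ≤ n, H' j = H j)
    (hlt : Nat.card (H (n + 1)).verts < Nat.card (H' (n + 1)).verts) :
    List.Lex (· < ·) (earOrders m H) (earOrders m' H') := by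
  induction n generalizing m m' H H' with
  | zero =>
    obtain ⟨m, rfl⟩ : ∃ k, m = k + 1 := ⟨m - 1, by omega⟩
    obtain ⟨m', rfl⟩ : ∃ k, m' = k + 1 := ⟨m' - 1, by omega⟩
    simp only [earOrders, List.range_succ_eq_map, List.map_cons]
    exact List.Lex.rel hlt
  | succ n ih =>
    obtain ⟨m, rfl⟩ : ∃ k, m = k + 1 := ⟨m - 1, by omega⟩
    obtain ⟨m', rfl⟩ : ∃ k, m' = k + 1 := ⟨m' - 1, by omega⟩
    simp only [earOrders, List.range_succ_eq_map, List.map_cons, List.map_map]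
    rw [heq (0 + 1) (by omega)]
    refine List.Lex.cons ?_
    exact ih (m := m) (m' := m') (H := fun j => H (j + 1)) (H' := fun j => H' (j + 1))
      (by omega) (by omega) (fun j hj => heq (j + 1) (by omega)) hlt

/-- In a lexicographically maximal odd ear decomposition, the `i`-th ear cannot be replaced by a
longer one after which the remaining vertices can still be reached by adding ears. -/
theorem IsMaxOddEarDecomp.not_earReachable {V : Type*} {G : SimpleGraph V} {m : ℕ}
    {H : ℕ → G.Subgraph} (hmax : IsMaxOddEarDecomp G m H) {i : ℕ} (hi : 2 ≤ i) (him : i ≤ m)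
    {a b : V} {q : List V} (hq : IsEarList G (prevVerts H i) a q b) (hne : q ≠ [])
    (hlen : Nat.card (H i).verts ≤ q.length) :
    ¬ EarReachable G (prevVerts H i ∪ {x | x ∈ q}) Set.univ := by
  intro hreach
  obtain ⟨n, rfl⟩ : ∃ n, i = n + 1 := ⟨i - 1, by omega⟩
  have hpart := hmax.1.isPartialOddEarDecomp
  obtain ⟨H', hH', hold, hprev, hcard⟩ := (hpart.of_le (by omega) (by omega)).exists_extend hq hne
  obtain ⟨m', H'', hm', hH'', hold', hcover⟩ := hreach.exists_extend hH' hprev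
  refine hmax.2 m' H'' (hH''.isOddEarDecomp hcover) ?_
  refine lex_earOrders (n := n) (by omega) (by omega) ?_ ?_
  · intro j hj
    rw [hold' j (by omega), hold j hj]
  · rw [hold' (n + 1) le_rfl]
    omega

theorem IsPartialOddEarDecomp.exists_descending_path {V : Type*} {G : SimpleGraph V} {m : ℕ}
    {H : ℕ → G.Subgraph} (h : IsPartialOddEarDecomp G m H) {ht : V → ℕ}
    (hrec : ∀ i, 2 ≤ i → i ≤ m → ∀ x ∈ earQVerts H i,
      ∃ (y : V) (W : G.Walk x y), W.IsPath ∧ (∀ e ∈ W.edges, e ∈ (H i).edgeSet) ∧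
        Even W.length ∧ y ∈ prevVerts H i ∧
        (∀ z ∈ W.support, z ∈ prevVerts H i → z = y) ∧ ht x = ht y + 1)
    {i h₀ : ℕ} (hi : 2 ≤ i) (hlow : ∀ v ∈ earQVerts H i, h₀ ≤ ht v) (k : ℕ) :
    k ≤ m → ∀ v ∈ prevVerts H (k + 1), v ∉ earQVerts H i → ht v ≤ h₀ →
      ∃ (y : V) (R : G.Walk v y), R.IsPath ∧ Even R.length ∧ y ∈ prevVerts H i ∧
        (∀ z ∈ R.support, z ∈ prevVerts H (i + 1) → z = y) ∧
        (∀ z ∈ R.support, z ∈ prevVerts H (k + 1)) ∧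
        ∀ j, i < j → j ≤ m →
          HasEarOver G (prevVerts H j ∪ {z | z ∈ R.support}) (H j).verts := by
  induction k with
  | zero =>
    rintro - v ⟨j, hj, hj', -⟩
    omega
  | succ k ih =>
    intro hkm v hv hvQ hvh
    by_cases hvi : v ∈ prevVerts H i
    · refine ⟨v, Walk.nil, Walk.IsPath.nil, by simp, hvi, by simp, by simpa using hv, ?_⟩
      intro j hij hjm
      refine (h.isOddEar j (by omega) hjm).hasEarOver.mono Set.subset_union_left ?_
      rintro x - (hx | hx)
      · exact hx
      · obtain rfl : x = v := by simpa using hx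
        exact prevVerts_mono H hij.le hvi
    by_cases hvk : v ∈ prevVerts H (k + 1)
    · obtain ⟨y, R, h1, h2, h3, h4, h5, h6⟩ := ih (by omega) v hvk hvQ hvh
      exact ⟨y, R, h1, h2, h3, h4, fun z hz => prevVerts_mono H (Nat.le_succ _) (h5 z hz), h6⟩
    have hvH : v ∈ (H (k + 1)).verts := by
      rw [prevVerts_succ H (by omega)] at hv
      exact hv.resolve_left hvk
    have hik : i < k + 1 := by
      rcases lt_trichotomy i (k + 1) with hlt | rfl | hlt
      · exact hlt
      · exact absurd ⟨hvH, hvk⟩ hvQ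
      · exact absurd ⟨k + 1, by omega, hlt, hvH⟩ hvi
    obtain ⟨y', W, hW, he, heven, hy', hWS, hht⟩ := hrec (k + 1) (by omega) hkm v ⟨hvH, hvk⟩
    obtain ⟨y, R, h1, h2, h3, h4, h5, h6⟩ := ih (by omega) y' hy'
      (fun hQ => by have := hlow y' hQ; omega) (by omega)
    have hodd := h.isOddEar (k + 1) (by omega) hkm
    have hWH : ∀ z ∈ W.support, z ∈ (H (k + 1)).verts := fun z hz =>
      hodd.mem_verts_of_mem_support W ⟨hvH, hvk⟩ hW he hy' hWS hz
    have hRk : ∀ z ∈ (W.append R).support, z ∈ prevVerts H (k + 2) := by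
      intro z hz
      rw [prevVerts_succ H (by omega)]
      rcases (Walk.mem_support_append_iff _ _).1 hz with hz | hz
      · exact Or.inr (hWH z hz)
      · exact Or.inl (h5 z hz)
    refine ⟨y, W.append R, ?_, ?_, h3, ?_, hRk, ?_⟩
    · have hnodup := h1.support_nodup
      rw [← Walk.cons_tail_support, List.nodup_cons] at hnodup
      rw [Walk.isPath_def, Walk.support_append, List.nodup_append]
      refine ⟨hW.support_nodup, hnodup.2, ?_⟩
      rintro a ha _ hb rfl
      obtain rfl := hWS a ha (h5 a (List.mem_of_mem_tail hb))
      exact hnodup.1 hb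
    · rw [Walk.length_append]
      exact heven.add h2
    · intro z hz hzi
      rcases (Walk.mem_support_append_iff _ _).1 hz with hz | hz
      · obtain rfl := hWS z hz (prevVerts_mono H hik hzi)
        exact h4 z R.start_mem_support hzi
      · exact h4 z hz hzi
    · intro j hij hjm
      rcases lt_trichotomy j (k + 1) with hlt | rfl | hlt
      · refine (h6 j hij hjm).mono ?_ ?_
        · exact Set.union_subset_union_right _ fun z hz =>
            (Walk.mem_support_append_iff _ _).2 (Or.inr hz)
        · rintro x hxj (hx | hx)
          · exact Or.inl hx
          · right
            rcases (Walk.mem_support_append_iff _ _).1 hx with hx | hx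
            · obtain rfl := hWS x hx ⟨j, by omega, hlt, hxj⟩
              exact R.start_mem_support
            · exact hx
      · refine (hodd.hasEarOver_union_support W ⟨hvH, hvk⟩ hW he hy' hWS heven).mono ?_ ?_
        · exact Set.union_subset_union_right _ fun z hz =>
            (Walk.mem_support_append_iff _ _).2 (Or.inl hz)
        · rintro x - (hx | hx)
          · exact Or.inl hx
          · rcases (Walk.mem_support_append_iff _ _).1 hx with hx | hx
            · exact Or.inr hx
            · exact Or.inl (h5 x hx)
      · refine (h.isOddEar j (by omega) hjm).hasEarOver.mono Set.subset_union_left ?_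
        rintro x - (hx | hx)
        · exact hx
        · exact prevVerts_mono H hlt (hRk x hx)

theorem IsMaxOddEarDecomp.not_adj_of_lt {V : Type*} {G : SimpleGraph V} {m : ℕ}
    {H : ℕ → G.Subgraph} (hmax : IsMaxOddEarDecomp G m H) {ht : V → ℕ}
    (hrec : ∀ i, 2 ≤ i → i ≤ m → ∀ x ∈ earQVerts H i,
      ∃ (y : V) (W : G.Walk x y), W.IsPath ∧ (∀ e ∈ W.edges, e ∈ (H i).edgeSet) ∧
        Even W.length ∧ y ∈ prevVerts H i ∧
        (∀ z ∈ W.support, z ∈ prevVerts H i → z = y) ∧ ht x = ht y + 1)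
    {i i' : ℕ} (hi : 2 ≤ i) (hii' : i < i') (hi'm : i' ≤ m) {u u' : V}
    (hu : u ∈ earQVerts H i) (hend : IsEndvertex ((H i).deleteVerts (prevVerts H i)) u)
    (hu' : u' ∈ earQVerts H i') (hlow : ∀ v ∈ earQVerts H i, ht u' ≤ ht v) :
    ¬ G.Adj u u' := by
  intro hadj
  have hpart := hmax.1.isPartialOddEarDecomp
  have hu'i : u' ∉ prevVerts H (i + 1) := fun hmem => hu'.2 (prevVerts_mono H hii' hmem)
  rw [prevVerts_succ H (by omega), Set.mem_union, not_or] at hu'i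
  obtain ⟨y, R, hR, hReven, hy, hRi, -, hears⟩ :=
    hpart.exists_descending_path hrec hi hlow m le_rfl u' ⟨i', by omega, by omega, hu'.1⟩
      (fun hQ => hu'i.2 hQ.1) le_rfl
  obtain ⟨y₀, W, hW, he, heven, hy₀, hWS, -⟩ := hrec i hi (by omega) u hu
  have hodd := hpart.isOddEar i hi (by omega)
  have hWH : ∀ z ∈ W.support, z ∈ (H i).verts := fun z hz =>
    hodd.mem_verts_of_mem_support W hu hW he hy₀ hWS hz
  obtain ⟨hcov, hcard⟩ := hodd.subset_support_of_isEndvertex W hu hW he hy₀ hWS heven hend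
  obtain ⟨p, hp⟩ : ∃ p, W.reverse.support = y₀ :: p :=
    ⟨_, (Walk.cons_tail_support W.reverse).symm⟩
  obtain ⟨r, hr⟩ : ∃ r, R.support = r ++ [y] := by
    refine ⟨R.support.dropLast, ?_⟩
    conv_lhs => rw [← List.dropLast_append_getLast (Walk.support_ne_nil R), Walk.getLast_support]
  have hpnodup := hW.reverse.support_nodup
  have hrnodup := hR.support_nodup
  rw [hp, List.nodup_cons] at hpnodup
  rw [hr, List.nodup_append] at hrnodup
  have hpW : ∀ z, z ∈ W.support ↔ z = y₀ ∨ z ∈ p := by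
    intro z
    rw [← List.mem_cons, ← hp, Walk.support_reverse, List.mem_reverse]
  have hrR : ∀ z, z ∈ R.support ↔ z ∈ r ∨ z = y := by
    intro z
    rw [hr, List.mem_append, List.mem_singleton]
  have hpQ : ∀ z ∈ p, z ∈ earQVerts H i := by
    intro z hz
    have hzW := (hpW z).2 (Or.inr hz)
    refine ⟨hWH z hzW, fun hzi => ?_⟩
    obtain rfl := hWS z hzW hzi
    exact hpnodup.1 hz
  have hrQ : ∀ z ∈ r, z ∉ prevVerts H (i + 1) := by
    intro z hz hzi
    obtain rfl := hRi z ((hrR z).2 (Or.inl hz)) hzi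
    exact hrnodup.2.2 z hz z (by simp) rfl
  have hQi : ∀ z ∈ earQVerts H i, z ∈ prevVerts H (i + 1) := fun z hz =>
    ⟨i, by omega, by omega, hz.1⟩
  have hplen : p.length = W.length := by
    have := congrArg List.length hp
    rw [Walk.length_support, Walk.length_reverse, List.length_cons] at this
    omega
  have hrlen : r.length = R.length := by
    have := congrArg List.length hr
    rw [Walk.length_support, List.length_append, List.length_singleton] at this
    omega
  have hR2 : 2 ≤ R.length := by
    have h0 : R.length ≠ 0 := fun h0 => hu'i.1 (Walk.eq_of_length_eq_zero h0 ▸ hy)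
    obtain ⟨s, hs⟩ := hReven
    omega
  have hq : IsEarList G (prevVerts H i) y₀ (p ++ r) y := by
    refine ⟨hy₀, hy, ?_, ?_, ?_, ?_⟩
    · rw [List.nodup_append]
      refine ⟨hpnodup.2, hrnodup.1, ?_⟩
      rintro a ha _ hb rfl
      exact hrQ a hb (hQi a (hpQ a ha))
    · rw [List.length_append, hplen, hrlen]
      exact heven.add hReven
    · intro x hx
      rcases List.mem_append.1 hx with hx | hx
      · exact (hpQ x hx).2
      · exact fun hxi => hrQ x hx (prevVerts_mono H (Nat.le_succ i) hxi)
    · have hchain := (W.reverse.append (Walk.cons hadj R)).isChain_adj_support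
      rw [Walk.support_append, Walk.support_cons, List.tail_cons, hp, hr] at hchain
      simpa using hchain
  refine hmax.not_earReachable hi (by omega) hq ?_ ?_ ?_
  · intro h0
    have := congrArg List.length h0
    rw [List.length_append, List.length_nil] at this
    omega
  · rw [List.length_append]
    omega
  have hstart : prevVerts H i ∪ {x | x ∈ p ++ r} =
      prevVerts H (i + 1) ∪ {x | x ∈ R.support} := by
    ext x
    rw [prevVerts_succ H (by omega)]
    simp only [Set.mem_union, Set.mem_ofPred_eq, List.mem_append, hrR]
    constructor
    · rintro (hx | hx | hx)
      · exact Or.inl (Or.inl hx)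
      · exact Or.inl (Or.inr (hpQ x hx).1)
      · exact Or.inr (Or.inl hx)
    · rintro ((hx | hx) | hx | rfl)
      · exact Or.inl hx
      · by_cases hxi : x ∈ prevVerts H i
        · exact Or.inl hxi
        · rcases (hpW x).1 (hcov x ⟨hx, hxi⟩) with rfl | hxp
          · exact absurd hy₀ hxi
          · exact Or.inr (Or.inl hxp)
      · exact Or.inr (Or.inr hx)
      · exact Or.inl hy
  have hreach : ∀ j, i + 1 ≤ j → j ≤ m + 1 →
      EarReachable G (prevVerts H i ∪ {x | x ∈ p ++ r})
        (prevVerts H j ∪ {x | x ∈ R.support}) := by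
    intro j hj
    induction j, hj using Nat.le_induction with
    | base =>
      intro _
      rw [← hstart]
      exact EarReachable.refl
    | succ j hj ih =>
      intro hjm
      rw [prevVerts_succ H (by omega), Set.union_right_comm]
      exact (ih (by omega)).union_of_hasEarOver (hears j hj (by omega))
  have huniv : prevVerts H (m + 1) ∪ {x | x ∈ R.support} = Set.univ := by
    refine Set.eq_univ_of_forall fun v => Or.inl ?_
    obtain ⟨j, hj, hj', hv⟩ := hmax.1.2.2.1 v
    exact ⟨j, hj, by omega, hv⟩
  rw [← huniv]
  exact hreach (m + 1) (by omega) le_rfl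

/-- Let `G` be a hypomatchable graph of order at least three, and let `(H 1, …, H m)` be an
odd ear decomposition of `G` satisfying (H1).  Let `ht : V → ℕ` be the height function:
`ht x = 0` on `V(Q(1)) = V(H 1)`, and for `2 ≤ i ≤ m` and `x ∈ V(Q(i))`, `ht x = ht y + 1`,
where `y = y_x` is the endvertex in `⋃_{1 ≤ j ≤ i-1} V(H_j)` of the odd-order one, `H_i(x)`,
of the two edge-disjoint paths on `H i` connecting `x` and `⋃_{1 ≤ j ≤ i-1} V(H_j)` (a path
of odd order has an even number of edges; such a path meets `⋃_{1 ≤ j ≤ i-1} V(H_j)` only in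
its endvertex `y`).  Let `htH i = min{ht y : y ∈ V(Q(i))}` be the height of `H i`, and for
`2 ≤ i ≤ m` let `u i` be an endvertex of the path `Q(i)` with `ht (u i) = htH i`.  Then, for
any `h₀` with `1 ≤ h₀ ≤ max{htH i : 1 ≤ i ≤ m}`, the set
`{u i : 2 ≤ i ≤ m, htH i = h₀}` is an independent set of `G`. -/
theorem stmt6 {V : Type} [Fintype V] (G : SimpleGraph V) (hG : Hypomatchable G)
    (hV : 3 ≤ Nat.card V) (m : ℕ) (H : ℕ → G.Subgraph)
    (hmax : IsMaxOddEarDecomp G m H)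
    (ht : V → ℕ) (htH : ℕ → ℕ) (u : ℕ → V)
    (hht0 : ∀ x ∈ (H 1).verts, ht x = 0)
    (hrec : ∀ i, 2 ≤ i → i ≤ m → ∀ x ∈ earQVerts H i,
      ∃ (y : V) (W : G.Walk x y), W.IsPath ∧ (∀ e ∈ W.edges, e ∈ (H i).edgeSet) ∧
        Even W.length ∧ y ∈ prevVerts H i ∧
        (∀ z ∈ W.support, z ∈ prevVerts H i → z = y) ∧ ht x = ht y + 1)
    (hhtH : ∀ i, 1 ≤ i → i ≤ m → htH i = sInf (ht '' earQVerts H i))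
    (hu : ∀ i, 2 ≤ i → i ≤ m → u i ∈ earQVerts H i ∧
      IsEndvertex ((H i).deleteVerts (prevVerts H i)) (u i) ∧ ht (u i) = htH i)
    (h₀ : ℕ) (hh₀1 : 1 ≤ h₀) (hh₀m : ∃ i, 1 ≤ i ∧ i ≤ m ∧ h₀ ≤ htH i) :
    ∀ i, 2 ≤ i → i ≤ m → htH i = h₀ → ∀ i', 2 ≤ i' → i' ≤ m → htH i' = h₀ →
      ¬ G.Adj (u i) (u i') := by
  have hlow : ∀ i, 2 ≤ i → i ≤ m → ∀ v ∈ earQVerts H i, htH i ≤ ht v := by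
    intro i hi him v hv
    rw [hhtH i (by omega) him]
    exact Nat.sInf_le ⟨v, hv, rfl⟩
  intro i hi him hih i' hi' hi'm hi'h
  obtain ⟨h1, h2, h3⟩ := hu i hi him
  obtain ⟨h1', h2', h3'⟩ := hu i' hi' hi'm
  rcases lt_trichotomy i i' with hlt | rfl | hlt
  · refine hmax.not_adj_of_lt hrec hi hlt hi'm h1 h2 h1' fun v hv => ?_
    rw [h3', hi'h, ← hih]
    exact hlow i hi him v hv
  · exact G.loopless.irrefl _
  · refine fun hadj => hmax.not_adj_of_lt hrec hi' hlt him h1' h2' h1 (fun v hv => ?_) hadj.symm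
    rw [h3, hih, ← hi'h]
    exact hlow i' hi' hi'm v hv
end

section
/- Let k ≥ 2 be an integer, let H be the graph on 8 vertices x₁, …, x₈ consisting of the cycle x₁x₂⋯x₈x₁ together with the chords x₂x₄, x₄x₆, x₆x₈, x₈x₂, with u = x₁ and v = x₅, and let X ⊆ V(H) be a set with {u, v} ⊆ X. If ∑_{0≤j≤k−1} c_{2j+1}(H−X) = 2, then |X| ≥ 4. -/
open SimpleGraph

/-- The number of connected components of `G - X` having exactly `j` vertices. -/
noncomputable def cComp {V : Type*} (G : SimpleGraph V) (X : Set V) (j : ℕ) : ℕ :=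
  Nat.card {C : (G.induce Xᶜ).ConnectedComponent // Nat.card C.supp = j}

/-- The graph `H` on 8 vertices `x₁, …, x₈` (represented by `0, …, 7`): the cycle
`x₁x₂⋯x₈x₁` together with the chords `x₂x₄, x₄x₆, x₆x₈, x₈x₂`. -/
def Hgraph : SimpleGraph (Fin 8) :=
  SimpleGraph.fromRel (fun a b =>
    b.val = (a.val + 1) % 8 ∨ (a.val % 2 = 1 ∧ b.val = (a.val + 2) % 8))

instance : DecidableRel Hgraph.Adj := fun a b =>
  inferInstanceAs (Decidable (a ≠ b ∧ (_ ∨ _)))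

/-- The components counted by `cComp` for distinct sizes are distinct components of `G - X`. -/
theorem sum_cComp_le_card_connectedComponent {V : Type*} [Finite V] (G : SimpleGraph V)
    (X : Set V) {f : ℕ → ℕ} (hf : Function.Injective f) (s : Finset ℕ) :
    ∑ j ∈ s, cComp G X (f j) ≤ Nat.card (G.induce Xᶜ).ConnectedComponent := by
  have hsum : ∑ j ∈ s, cComp G X (f j) =
      Nat.card (Σ j : s, {C : (G.induce Xᶜ).ConnectedComponent // Nat.card C.supp = f j}) := by
    rw [Nat.card_sigma, ← Finset.sum_coe_sort s]
    rfl
  rw [hsum]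
  refine Nat.card_le_card_of_injective (fun p => p.2.1) ?_
  rintro ⟨i, C, hC⟩ ⟨j, D, hD⟩ (rfl : C = D)
  obtain rfl : i = j := Subtype.ext (hf (hC.symm.trans hD))
  rfl

set_option maxRecDepth 10000 in
/-- Deleting at most three vertices, among them `x₁` and `x₅`, leaves a vertex that every other
remaining vertex reaches in at most two steps. -/
theorem Hgraph_exists_center : ∀ X : Finset (Fin 8), 0 ∈ X → 4 ∈ X → X.card < 4 →
    ∃ r ∉ X, ∀ a ∉ X, ∃ c ∉ X, (a = c ∨ Hgraph.Adj a c) ∧ (c = r ∨ Hgraph.Adj c r) := by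
  decide

theorem Hgraph_induce_compl_preconnected (X : Finset (Fin 8)) (h0 : 0 ∈ X) (h4 : 4 ∈ X)
    (hcard : X.card < 4) : (Hgraph.induce (X : Set (Fin 8))ᶜ).Preconnected := by
  obtain ⟨r, hr, hcenter⟩ := Hgraph_exists_center X h0 h4 hcard
  have step : ∀ a b : ((X : Set (Fin 8))ᶜ : Set (Fin 8)), (a.1 = b.1 ∨ Hgraph.Adj a b) →
      (Hgraph.induce (X : Set (Fin 8))ᶜ).Reachable a b := by
    rintro a b (h | h)
    · rw [Subtype.ext h]
    · exact Adj.reachable (G := Hgraph.induce _) h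
  have toCenter : ∀ a, (Hgraph.induce (X : Set (Fin 8))ᶜ).Reachable a ⟨r, by simpa using hr⟩ := by
    intro a
    obtain ⟨c, hc, hac, hcr⟩ := hcenter a.1 (fun h => a.2 (Finset.mem_coe.2 h))
    exact (step a ⟨c, by simpa using hc⟩ hac).trans (step _ _ hcr)
  exact fun a b => (toCenter a).trans (toCenter b).symm

/-- For `k ≥ 2`, `u = x₁`, `v = x₅`, and `X ⊆ V(H)` with `{u, v} ⊆ X`:
if `∑_{0 ≤ j ≤ k-1} c_{2j+1}(H - X) = 2`, then `|X| ≥ 4`. -/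
theorem stmt11 (k : ℕ) (hk : 2 ≤ k) (X : Set (Fin 8)) (hX : (0 : Fin 8) ∈ X ∧ (4 : Fin 8) ∈ X)
    (h2 : ∑ j ∈ Finset.range k, cComp Hgraph X (2 * j + 1) = 2) :
    4 ≤ Nat.card X := by
  classical
  by_contra! hcard
  have hsub : Subsingleton (Hgraph.induce Xᶜ).ConnectedComponent := by
    have hpre := Hgraph_induce_compl_preconnected X.toFinset (by simpa using hX.1)
      (by simpa using hX.2) (by rwa [Set.toFinset_card, ← Nat.card_eq_fintype_card])
    rw [Set.coe_toFinset] at hpre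
    exact hpre.subsingleton_connectedComponent
  have hle := sum_cComp_le_card_connectedComponent Hgraph X
    (f := fun j => 2 * j + 1) (fun i j h => by simpa using h) (Finset.range k)
  have hone := Finite.card_le_one_iff_subsingleton.mpr hsub
  omega
end

section
/- For every subset X ⊆ V(Q), ∑_{0≤j≤k−1} c_{2j+1}(Q−X) ≤ ((2m+1)/(4m+l))·|X| + (m−7)/(8m+2l). -/
open SimpleGraph

/-- `l = 2⌊(k-12)/17⌋`. -/
def lP (k : ℕ) : ℕ := 2 * ((k - 12) / 17)

/-- `m = ⌊(2k-l+1)/8⌋`. -/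
def mP (k : ℕ) : ℕ := (2 * k - lP k + 1) / 8

/-- `r = 2k+1-l-8m`. -/
def rP (k : ℕ) : ℕ := 2 * k + 1 - lP k - 8 * mP k

/-- The vertex type of the graph `T`: `m` disjoint copies of `H` together with a set `R`
of `r` further vertices. -/
abbrev TV (k : ℕ) : Type := (Fin (mP k) × Fin 8) ⊕ Fin (rP k)

/-- Membership in `U ∪ R`, where `U = {uᵢ, vᵢ : 1 ≤ i ≤ m}` consists of the copies of
`u = x₁ = 0` and `v = x₅ = 4`, and `R` is the set of `r` extra vertices. -/
def inUR (k : ℕ) : TV k → Prop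
  | Sum.inl (_, a) => a = 0 ∨ a = 4
  | Sum.inr _ => True

/-- The graph `T`: the disjoint union `H₁ ∪ ⋯ ∪ H_m` together with the vertices of `R`,
where all pairs of distinct vertices of `U ∪ R` are joined. -/
def Tgraph (k : ℕ) : SimpleGraph (TV k) :=
  SimpleGraph.fromRel (fun s t =>
    (match s, t with
      | Sum.inl (i, a), Sum.inl (j, b) => i = j ∧ Hgraph.Adj a b
      | _, _ => False) ∨ (inUR k s ∧ inUR k t))

/-- The vertex type of `Q = L + T` where `L` is a complete graph of order `l`. -/
abbrev QV (k : ℕ) : Type := Fin (lP k) ⊕ TV k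

/-- The graph `Q = L + T`, the join of the complete graph `L` of order `l` with `T`. -/
def Qgraph (k : ℕ) : SimpleGraph (QV k) :=
  SimpleGraph.fromRel (fun x y =>
    match x, y with
    | Sum.inl _, _ => True
    | Sum.inr s, Sum.inr t => (Tgraph k).Adj s t
    | _, _ => False)


theorem parameter_facts (k : ℕ) (hk : 29 ≤ k) :
    2 ≤ lP k ∧ 7 ≤ mP k ∧ 2 * lP k + 3 ≤ mP k ∧ lP k + 8 * mP k + rP k = 2 * k + 1 := by
  unfold rP mP lP
  omega

theorem card_QV (k : ℕ) (hk : 29 ≤ k) : Nat.card (QV k) = 2 * k + 1 := by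
  have := (parameter_facts k hk).2.2.2
  simp only [QV, TV, Nat.card_eq_fintype_card, Fintype.card_sum, Fintype.card_prod,
    Fintype.card_fin]
  omega

/-- The numbers of components of finitely many distinct sizes add up to at most the number of
all components. -/
theorem sum_cComp_le {V : Type*} [Finite V] (G : SimpleGraph V) (X : Set V) (k : ℕ) :
    ∑ j ∈ Finset.range k, cComp G X (2 * j + 1) ≤
      Nat.card (G.induce Xᶜ).ConnectedComponent := by
  classical
  have := Fintype.ofFinite (G.induce Xᶜ).ConnectedComponent
  have hc : ∀ j, cComp G X (2 * j + 1) = (Finset.univ.filter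
      fun C : (G.induce Xᶜ).ConnectedComponent => Nat.card C.supp = 2 * j + 1).card := by
    intro j
    rw [cComp, Nat.card_eq_fintype_card, Fintype.card_subtype]
  simp only [hc]
  rw [← Finset.card_biUnion]
  · rw [Nat.card_eq_fintype_card]
    exact Finset.card_le_univ _
  · intro i _ j _ hij
    rw [Function.onFun, Finset.disjoint_left]
    intro C h1 h2
    simp only [Finset.mem_filter] at h1 h2
    omega

theorem Qgraph_adj_inl (k : ℕ) (p : Fin (lP k)) (y : QV k) (h : Sum.inl p ≠ y) :
    (Qgraph k).Adj (Sum.inl p) y := by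
  rw [Qgraph, fromRel_adj]
  exact ⟨h, Or.inl trivial⟩

theorem Qgraph_adj_of_inUR (k : ℕ) (s t : TV k) (hs : inUR k s) (ht : inUR k t) (h : s ≠ t) :
    (Qgraph k).Adj (Sum.inr s) (Sum.inr t) := by
  rw [Qgraph, fromRel_adj]
  refine ⟨fun e => h (Sum.inr.inj e), Or.inl ?_⟩
  change (Tgraph k).Adj _ _
  rw [Tgraph, fromRel_adj]
  exact ⟨h, Or.inl (Or.inr ⟨hs, ht⟩)⟩

theorem Qgraph_adj_of_block (k : ℕ) (i : Fin (mP k)) (a b : Fin 8) (h : Hgraph.Adj a b) :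
    (Qgraph k).Adj (Sum.inr (Sum.inl (i, a))) (Sum.inr (Sum.inl (i, b))) := by
  have hne := h.ne
  rw [Qgraph, fromRel_adj]
  refine ⟨by simpa using hne, Or.inl ?_⟩
  change (Tgraph k).Adj _ _
  rw [Tgraph, fromRel_adj]
  exact ⟨by simpa using hne, Or.inl (Or.inl ⟨rfl, h⟩)⟩

theorem Hgraph_adj_iff (a b : Fin 8) : Hgraph.Adj a b ↔ a ≠ b ∧
    ((b.val = (a.val + 1) % 8 ∨ (a.val % 2 = 1 ∧ b.val = (a.val + 2) % 8)) ∨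
      (a.val = (b.val + 1) % 8 ∨ (b.val % 2 = 1 ∧ a.val = (b.val + 2) % 8))) := by
  rw [Hgraph, fromRel_adj]

/-- The two triangles `x₂x₃x₄` and `x₆x₇x₈` are cliques of `H`. -/
theorem Hgraph_adj_of_same_side : ∀ a b : Fin 8, a ≠ 0 → a ≠ 4 → b ≠ 0 → b ≠ 4 →
    (a < 4 ↔ b < 4) → a ≠ b → Hgraph.Adj a b := by
  simp only [Hgraph_adj_iff]
  decide

/-- If the number of vertices of `L` and the number of deleted block vertices are large enough
compared to `n`, the bound of the main inequality is at least `1 + n`. -/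
theorem one_add_le_bound (l m n x : ℝ) (hl : 2 ≤ l) (hm : 7 ≤ m) (hn : n ≤ 2 * m)
    (hx : l + 2 * n ≤ x) :
    1 + n ≤ (2 * m + 1) / (4 * m + l) * x + (m - 7) / (8 * m + 2 * l) := by
  have h2 : 0 ≤ (m - 7) / (8 * m + 2 * l) := div_nonneg (by linarith) (by linarith)
  have h1 : 1 + n ≤ (2 * m + 1) / (4 * m + l) * x := by
    rw [div_mul_eq_mul_div, le_div_iff₀ (by linarith)]
    nlinarith [mul_nonneg (sub_nonneg.2 hn) (sub_nonneg.2 hl),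
      mul_le_mul_of_nonneg_left hx (by linarith : 0 ≤ 2 * m + 1)]
  linarith

theorem one_le_bound (l m x : ℝ) (hl : 2 ≤ l) (hm : 2 * l + 3 ≤ m) (hx : 2 ≤ x) :
    1 ≤ (2 * m + 1) / (4 * m + l) * x + (m - 7) / (8 * m + 2 * l) := by
  have h : (2 * m + 1) / (4 * m + l) * x + (m - 7) / (8 * m + 2 * l) =
      ((4 * m + 2) * x + (m - 7)) / (8 * m + 2 * l) := by
    have h4 : 4 * m + l ≠ 0 := by linarith
    have h8 : 8 * m + 2 * l = 2 * (4 * m + l) := by ring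
    rw [h8]
    field_simp
    ring
  rw [h, le_div_iff₀ (by linarith)]
  nlinarith

/-- A set of vertices of `H` meeting the edges that leave the sides `x₂x₃x₄` (if `p`) and
`x₆x₇x₈` (if `q`) has at least `2`, respectively `4`, elements. -/
theorem two_mul_sides_le (S : Finset (Fin 8)) (p q : Prop) [Decidable p] [Decidable q]
    (hp : p → (1 ∈ S ∨ 0 ∈ S) ∧ (3 ∈ S ∨ 4 ∈ S))
    (hq : q → (7 ∈ S ∨ 0 ∈ S) ∧ (5 ∈ S ∨ 4 ∈ S))
    (hpq : p → q → (1 ∈ S ∨ 7 ∈ S) ∧ (3 ∈ S ∨ 5 ∈ S)) :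
    2 * ((if p then 1 else 0) + (if q then 1 else 0)) ≤ S.card := by
  have hS : S.card = ∑ a : Fin 8, if a ∈ S then 1 else 0 := by simp
  have hcover : ∀ a b, a ∈ S ∨ b ∈ S →
      1 ≤ (if a ∈ S then 1 else 0) + (if b ∈ S then 1 else 0) := by
    rintro a b (h | h) <;> simp [h]
  rw [hS, Fin.sum_univ_eight]
  by_cases hp' : p <;> by_cases hq' : q <;> simp only [hp', hq', if_true, if_false]
  · have h1 := hcover _ _ (hp hp').1
    have h2 := hcover _ _ (hp hp').2
    have h3 := hcover _ _ (hq hq').1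
    have h4 := hcover _ _ (hq hq').2
    have h5 := hcover _ _ (hpq hp' hq').1
    have h6 := hcover _ _ (hpq hp' hq').2
    omega
  · have h1 := hcover _ _ (hp hp').1
    have h2 := hcover _ _ (hp hp').2
    omega
  · have h3 := hcover _ _ (hq hq').1
    have h4 := hcover _ _ (hq hq').2
    omega
  · omega

/-- Two vertices of `Y` that are equal or adjacent lie in the same component of `G[Y]`. -/
theorem component_eq_of_adj {V : Type*} {G : SimpleGraph V} {Y : Set V} {x y : V}
    (hx : x ∈ Y) (hy : y ∈ Y) (h : x ≠ y → G.Adj x y) :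
    (G.induce Y).connectedComponentMk ⟨x, hx⟩ = (G.induce Y).connectedComponentMk ⟨y, hy⟩ := by
  by_cases e : x = y
  · subst e
    rfl
  · exact ConnectedComponent.sound (Adj.reachable (h e))

/-- If `X` contains `L`, the number of components of `Q - X` is at most `1 + n` for some
`n ≤ 2m` with `|X| ≥ l + 2n`. -/
theorem card_component_le (k : ℕ) (X : Set (QV k)) (hL : ∀ p, Sum.inl p ∈ X) :
    ∃ n : ℕ, Nat.card ((Qgraph k).induce Xᶜ).ConnectedComponent ≤ 1 + n ∧
      n ≤ 2 * mP k ∧ lP k + 2 * n ≤ Nat.card X := by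
  classical
  let G := (Qgraph k).induce Xᶜ
  let core : G.ConnectedComponent → Prop := fun C =>
    ∃ (s : TV k) (hs : Sum.inr s ∈ Xᶜ), inUR k s ∧ G.connectedComponentMk ⟨Sum.inr s, hs⟩ = C
  let side : Fin (mP k) → Bool → G.ConnectedComponent → Prop := fun i b C =>
    ∃ (a : Fin 8) (ha : Sum.inr (Sum.inl (i, a)) ∈ Xᶜ), a ≠ 0 ∧ a ≠ 4 ∧ (a < 4 ↔ b = true) ∧
      G.connectedComponentMk ⟨Sum.inr (Sum.inl (i, a)), ha⟩ = C
  have core_unique : ∀ C D, core C → core D → C = D := by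
    rintro C D ⟨s, hs, hus, rfl⟩ ⟨t, ht, hut, rfl⟩
    exact component_eq_of_adj hs ht fun h =>
      Qgraph_adj_of_inUR k s t hus hut (by rintro rfl; exact h rfl)
  have side_mk : ∀ i b C (a : Fin 8) (ha : Sum.inr (Sum.inl (i, a)) ∈ Xᶜ), side i b C → a ≠ 0 →
      a ≠ 4 → (a < 4 ↔ b = true) → G.connectedComponentMk ⟨Sum.inr (Sum.inl (i, a)), ha⟩ = C := by
    rintro i b C a ha ⟨a', ha', h0, h4, hb, rfl⟩ g0 g4 gb
    exact component_eq_of_adj ha ha' fun h => Qgraph_adj_of_block k i a a'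
      (Hgraph_adj_of_same_side a a' g0 g4 h0 h4 (gb.trans hb.symm) (by rintro rfl; exact h rfl))
  have side_unique : ∀ i b C D, side i b C → side i b D → C = D := by
    rintro i b C D hC ⟨a, ha, h0, h4, hb, rfl⟩
    exact (side_mk i b C a ha hC h0 h4 hb).symm
  let owned : Fin (mP k) → Bool → G.ConnectedComponent → Prop := fun i b C =>
    ¬ core C ∧ side i b C ∧ (b = false → ¬ side i true C)
  have cover : ∀ C, core C ∨ ∃ q : Fin (mP k) × Bool, owned q.1 q.2 C := by
    intro C
    refine or_iff_not_imp_left.2 fun hC => ?_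
    have hside : ∃ i b, side i b C := by
      induction C using ConnectedComponent.ind with | h v => ?_
      obtain ⟨v, hv⟩ := v
      rcases v with p | ⟨i, a⟩ | t
      · exact absurd (hL p) hv
      · have h04 : ¬ (a = 0 ∨ a = 4) := fun h => hC ⟨_, hv, h, rfl⟩
        push Not at h04
        exact ⟨i, decide (a < 4), a, hv, h04.1, h04.2, by simp, rfl⟩
      · exact absurd ⟨_, hv, trivial, rfl⟩ hC
    obtain ⟨i, b, h⟩ := hside
    by_cases ht : side i true C
    · exact ⟨(i, true), hC, ht, by simp⟩
    · exact ⟨(i, b), hC, h, fun _ => ht⟩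
  let bad : Fin (mP k) → Bool → Prop := fun i b => ∃ C, owned i b C
  let B : Finset (Fin (mP k) × Bool) := Finset.univ.filter fun q => bad q.1 q.2
  have touch : ∀ i b (a c : Fin 8), bad i b → a ≠ 0 → a ≠ 4 → (a < 4 ↔ b = true) →
      (c = 0 ∨ c = 4) → Hgraph.Adj a c →
      Sum.inr (Sum.inl (i, a)) ∈ X ∨ Sum.inr (Sum.inl (i, c)) ∈ X := by
    rintro i b a c ⟨C, hC, hs, -⟩ h0 h4 hb hc hac
    by_contra! hX
    refine hC ⟨_, hX.2, hc, ?_⟩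
    rw [← side_mk i b C a hX.1 hs h0 h4 hb]
    exact component_eq_of_adj hX.2 hX.1 fun _ => (Qgraph_adj_of_block k i a c hac).symm
  have separate : ∀ i (a c : Fin 8), bad i true → bad i false → a ≠ 0 → a ≠ 4 → c ≠ 0 → c ≠ 4 →
      a < 4 → ¬ c < 4 → Hgraph.Adj a c →
      Sum.inr (Sum.inl (i, a)) ∈ X ∨ Sum.inr (Sum.inl (i, c)) ∈ X := by
    intro i a c ht hf a0 a4 c0 c4 ha hc hac
    by_contra! hX
    obtain ⟨C, hC, hCs, -⟩ := ht
    obtain ⟨D, hD, hDs, hDt⟩ := hf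
    refine hDt rfl ?_
    rw [← side_mk i false D c hX.2 hDs c0 c4 (by simpa using hc),
      component_eq_of_adj hX.2 hX.1 fun _ => (Qgraph_adj_of_block k i a c hac).symm]
    exact ⟨a, hX.1, a0, a4, by simpa using ha, rfl⟩
  refine ⟨B.card, ?_, ?_, ?_⟩
  · have := Fintype.ofFinite G.ConnectedComponent
    have label : ∀ C, ∃ o : Option (Fin (mP k) × Bool),
        (core C ∧ o = none) ∨ ∃ q, owned q.1 q.2 C ∧ o = some q := by
      intro C
      rcases cover C with h | ⟨q, h⟩
      · exact ⟨none, Or.inl ⟨h, rfl⟩⟩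
      · exact ⟨some q, Or.inr ⟨q, h, rfl⟩⟩
    choose f hf using label
    rw [Nat.card_eq_fintype_card, add_comm, ← Finset.card_insertNone]
    refine Finset.card_le_card_of_injOn (s := Finset.univ) f ?_ ?_
    · intro C _
      rcases hf C with ⟨-, h⟩ | ⟨q, hq, h⟩
      · simp [h]
      · have : bad q.1 q.2 := ⟨C, hq⟩
        simpa [h, B] using this
    · intro C _ D _ h
      rcases hf C with ⟨hC, h1⟩ | ⟨q, hq, h1⟩ <;> rcases hf D with ⟨hD, h2⟩ | ⟨q', hq', h2⟩ <;>
        rw [h1, h2] at h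
      · exact core_unique C D hC hD
      · cases h
      · cases h
      · cases h
        exact side_unique _ _ C D hq.2.1 hq'.2.1
  · refine (Finset.card_le_univ B).trans ?_
    simp [mul_comm]
  · let S : Fin (mP k) → Finset (Fin 8) := fun i =>
      Finset.univ.filter fun a => Sum.inr (Sum.inl (i, a)) ∈ X
    have hS : ∀ i, 2 * ((if bad i true then 1 else 0) + (if bad i false then 1 else 0)) ≤
        (S i).card := by
      intro i
      refine two_mul_sides_le (S i) _ _ (fun h => ?_) (fun h => ?_) (fun h h' => ?_) <;>
        simp only [S, Finset.mem_filter, Finset.mem_univ, true_and]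
      · exact ⟨touch i true 1 0 h (by decide) (by decide) (by decide) (by decide)
          ((Hgraph_adj_iff _ _).2 (by decide)), touch i true 3 4 h (by decide) (by decide)
          (by decide) (by decide) ((Hgraph_adj_iff _ _).2 (by decide))⟩
      · exact ⟨touch i false 7 0 h (by decide) (by decide) (by decide) (by decide)
          ((Hgraph_adj_iff _ _).2 (by decide)), touch i false 5 4 h (by decide) (by decide)
          (by decide) (by decide) ((Hgraph_adj_iff _ _).2 (by decide))⟩
      · exact ⟨separate i 1 7 h h' (by decide) (by decide) (by decide) (by decide) (by decide)
          (by decide) ((Hgraph_adj_iff _ _).2 (by decide)), separate i 3 5 h h' (by decide)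
          (by decide) (by decide) (by decide) (by decide) (by decide)
          ((Hgraph_adj_iff _ _).2 (by decide))⟩
    have hB : B.card = ∑ i, ((if bad i true then 1 else 0) + (if bad i false then 1 else 0)) := by
      rw [Finset.card_filter, Fintype.sum_prod_type]
      exact Finset.sum_congr rfl fun i _ => Fintype.sum_bool _
    have hX : lP k + ∑ i, (S i).card ≤ Nat.card X := by
      have : Nat.card X = ∑ x, if x ∈ X then 1 else 0 := by
        rw [← Finset.card_filter, Nat.card_eq_fintype_card, ← Fintype.card_subtype]
      rw [this, Fintype.sum_sum_type, Fintype.sum_sum_type, Fintype.sum_prod_type]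
      simp only [S, Finset.card_filter, hL, if_true, Finset.sum_const, Finset.card_univ,
        Fintype.card_fin, smul_eq_mul, mul_one]
      omega
    calc lP k + 2 * B.card ≤ lP k + ∑ i, (S i).card := by
          rw [hB, Finset.mul_sum]
          exact Nat.add_le_add_left (Finset.sum_le_sum fun i _ => hS i) _
      _ ≤ Nat.card X := hX

/-- If `X` misses a vertex of `L`, all vertices of `Q - X` lie in one component. -/
theorem component_eq_of_notMem (k : ℕ) (X : Set (QV k)) (p : Fin (lP k)) (hp : Sum.inl p ∉ X)
    (C D : ((Qgraph k).induce Xᶜ).ConnectedComponent) : C = D := by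
  have h : ∀ C : ((Qgraph k).induce Xᶜ).ConnectedComponent,
      ((Qgraph k).induce Xᶜ).connectedComponentMk ⟨Sum.inl p, hp⟩ = C := by
    intro C
    induction C using ConnectedComponent.ind with | h v => ?_
    exact component_eq_of_adj hp v.2 (Qgraph_adj_inl k p v.1)
  rw [← h C, ← h D]

/-- If `G - X` has at most one component, it has no component whose size differs from the
number of vertices outside `X`. -/
theorem cComp_eq_zero {V : Type*} [Finite V] (G : SimpleGraph V) (X : Set V) (j : ℕ)
    (h : ∀ C D : (G.induce Xᶜ).ConnectedComponent, C = D) (hj : j + Nat.card X ≠ Nat.card V) :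
    cComp G X j = 0 := by
  rw [cComp, Nat.card_eq_zero]
  refine Or.inl ⟨fun ⟨C, hC⟩ => hj ?_⟩
  have hu : C.supp = Set.univ := Set.eq_univ_of_forall fun v => h _ _
  rw [hu, Nat.card_univ] at hC
  rw [← hC, add_comm, Nat.card_coe_set_eq, Nat.card_coe_set_eq]
  exact Set.ncard_add_ncard_compl X

/-- For `k ≥ 29` and every `X ⊆ V(Q)`,
`∑_{0 ≤ j ≤ k-1} c_{2j+1}(Q - X) ≤ ((2m+1)/(4m+l))·|X| + (m-7)/(8m+2l)`. -/
theorem stmt13 (k : ℕ) (hk : 29 ≤ k) (X : Set (QV k)) :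
    (∑ j ∈ Finset.range k, (cComp (Qgraph k) X (2 * j + 1) : ℝ)) ≤
      ((2 * (mP k : ℝ) + 1) / (4 * (mP k : ℝ) + (lP k : ℝ))) * Nat.card X +
        ((mP k : ℝ) - 7) / (8 * (mP k : ℝ) + 2 * (lP k : ℝ)) := by
  obtain ⟨hl, hm, hlm, -⟩ := parameter_facts k hk
  have hl' : (2 : ℝ) ≤ lP k := by exact_mod_cast hl
  have hm' : (7 : ℝ) ≤ mP k := by exact_mod_cast hm
  have hlm' : 2 * (lP k : ℝ) + 3 ≤ mP k := by exact_mod_cast hlm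
  have hsum := sum_cComp_le (Qgraph k) X k
  by_cases hL : ∀ p, Sum.inl p ∈ X
  · obtain ⟨n, hn, hnm, hnX⟩ := card_component_le k X hL
    refine le_trans ?_ (one_add_le_bound _ _ (n : ℝ) _ hl' hm' (by exact_mod_cast hnm)
      (by exact_mod_cast hnX))
    exact_mod_cast hsum.trans hn
  · push Not at hL
    obtain ⟨p, hp⟩ := hL
    have hone := component_eq_of_notMem k X p hp
    by_cases hX : 2 ≤ Nat.card X
    · refine le_trans ?_ (one_le_bound _ _ _ hl' hlm' (by exact_mod_cast hX))
      have : Subsingleton ((Qgraph k).induce Xᶜ).ConnectedComponent := ⟨hone⟩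
      exact_mod_cast hsum.trans (Finite.card_le_one_iff_subsingleton.2 this)
    · have h0 : ∑ j ∈ Finset.range k, (cComp (Qgraph k) X (2 * j + 1) : ℝ) = 0 := by
        refine Finset.sum_eq_zero fun j hj => ?_
        have hjk := Finset.mem_range.1 hj
        rw [cComp_eq_zero _ _ _ hone, Nat.cast_zero]
        rw [card_QV k hk]
        omega
      rw [h0]
      have : 0 ≤ ((mP k : ℝ) - 7) / (8 * mP k + 2 * lP k) :=
        div_nonneg (by linarith) (by linarith)
      positivity
end
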